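/- arXiv:2503.10537 — 7 statements merged into one kernel-verified Lean document; each statement's English description precedes it below -/
import Mathlib

section
/- Let 𝓗 be a well-structured preconditioner set in dimension d and let ε > 0, η̃ > 0, β₂ ∈ (0,1). Let 𝒳 ⊆ ℝ^d be a nonempty convex set, L̃_1,…,L̃_T : ℝ^d → ℝ differentiable convex functions, and let x_1 ∈ 𝒳 and sequences satisfy M̃_0 = ε·I_d and, for t = 1,…,T: g̃_t = ∇L̃_t(x_t); M̃_t = β₂·M̃_{t−1} + g̃_t g̃_tᵀ; H̃_t is a positive definite element of 𝓗 minimizing H ↦ ⟨M̃_t, H⁻¹⟩ + η̃²·Tr(H) over positive definite H ∈ 𝓗; and x_{t+1} is a point of 𝒳 minimizing y ↦ (y − (x_t − H̃_t⁻¹ g̃_t))ᵀ H̃_t (y − (x_t − H̃_t⁻¹ g̃_t)) over y ∈ 𝒳. Then for every x* ∈ 𝒳: Σ_{t=1}^T β₂^{(T−t)/2}·(L̃_t(x_t) − L̃_t(x*)) ≤ (D²/(2η̃) + η̃)·inf{√(⟨M̃_T, H⁻¹⟩) : H ∈ 𝓗 positive definite, Tr(H) ≤ 1}, where D = max_{1≤t≤T}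 ‖x_t − x*‖_𝓗. -/
open Matrix

/-- A set of real `d × d` matrices closed under scalar multiplication, addition and
matrix multiplication, containing the identity. -/
def IsMatrixSubalgebra {d : ℕ} (K : Set (Matrix (Fin d) (Fin d) ℝ)) : Prop :=
  (∀ (c : ℝ), ∀ A ∈ K, c • A ∈ K) ∧ (∀ A ∈ K, ∀ B ∈ K, A + B ∈ K) ∧
    (∀ A ∈ K, ∀ B ∈ K, A * B ∈ K) ∧ (1 : Matrix (Fin d) (Fin d) ℝ) ∈ K

/-- A well-structured preconditioner set: `𝓗 = 𝒦 ∩ S₊^d` for a matrix subalgebra `𝒦`. -/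
def WellStructured {d : ℕ} (𝓗 : Set (Matrix (Fin d) (Fin d) ℝ)) : Prop :=
  ∃ K : Set (Matrix (Fin d) (Fin d) ℝ),
    IsMatrixSubalgebra K ∧ 𝓗 = K ∩ {M | M.PosSemidef}

/-- `⟨A,B⟩ := Tr(Aᵀ B)` for square real matrices. -/
noncomputable def minner {n : Type*} [Fintype n] (A B : Matrix n n ℝ) : ℝ := (Aᵀ * B).trace

/-- The `𝓗`-norm `‖x‖_𝓗 = sup{√(xᵀHx) : H ∈ 𝓗, Tr(H) ≤ 1}`. -/
noncomputable def hNorm {d : ℕ} (𝓗 : Set (Matrix (Fin d) (Fin d) ℝ)) (x : Fin d → ℝ) : ℝ :=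
  sSup {r | ∃ H ∈ 𝓗, H.trace ≤ 1 ∧ r = Real.sqrt (x ⬝ᵥ H.mulVec x)}

/-- The adaptive gradient norm `|||g_{1:T}|||_𝓗`. -/
noncomputable def adaNorm {d : ℕ} (𝓗 : Set (Matrix (Fin d) (Fin d) ℝ)) (T : ℕ)
    (g : ℕ → Fin d → ℝ) : ℝ :=
  sInf {r | ∃ H ∈ 𝓗, H.PosDef ∧ H.trace ≤ 1 ∧
    r = Real.sqrt (∑ s ∈ Finset.Icc 1 T, g s ⬝ᵥ H⁻¹.mulVec (g s))}

/-- The gradient of `f : ℝ^d → ℝ` at `x`, componentwise. -/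
noncomputable def grad {d : ℕ} (f : (Fin d → ℝ) → ℝ) (x : Fin d → ℝ) : Fin d → ℝ :=
  fun i => fderiv ℝ f x (Pi.single i 1)

/-- AdaReg iterates (Algorithm 1) with preconditioner set `𝓗`, parameters `ε, η`,
constraint set `𝒳` and differentiable convex losses `L 1, …, L T`. -/
def AdaReg {d : ℕ} (𝓗 : Set (Matrix (Fin d) (Fin d) ℝ)) (ε η : ℝ)
    (𝒳 : Set (Fin d → ℝ)) (T : ℕ) (L : ℕ → (Fin d → ℝ) → ℝ)
    (x g : ℕ → Fin d → ℝ) (M H : ℕ → Matrix (Fin d) (Fin d) ℝ) : Prop :=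
  x 1 ∈ 𝒳 ∧ M 0 = ε • (1 : Matrix (Fin d) (Fin d) ℝ) ∧
  ∀ t, 1 ≤ t → t ≤ T →
    Differentiable ℝ (L t) ∧ ConvexOn ℝ Set.univ (L t) ∧
    g t = grad (L t) (x t) ∧
    M t = M (t - 1) + Matrix.vecMulVec (g t) (g t) ∧
    H t ∈ 𝓗 ∧ (H t).PosDef ∧
    (∀ H' ∈ 𝓗, H'.PosDef →
      minner (M t) (H t)⁻¹ + η ^ 2 * (H t).trace ≤ minner (M t) H'⁻¹ + η ^ 2 * H'.trace) ∧
    x (t + 1) ∈ 𝒳 ∧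
    (∀ y ∈ 𝒳,
      (x (t + 1) - (x t - (H t)⁻¹.mulVec (g t))) ⬝ᵥ
          (H t).mulVec (x (t + 1) - (x t - (H t)⁻¹.mulVec (g t))) ≤
      (y - (x t - (H t)⁻¹.mulVec (g t))) ⬝ᵥ
          (H t).mulVec (y - (x t - (H t)⁻¹.mulVec (g t))))

/-- Weighted (EMA-style) AdaReg iterates (Algorithm 4) with decay `β₂`. -/
def WeightedAdaReg {d : ℕ} (𝓗 : Set (Matrix (Fin d) (Fin d) ℝ)) (ε η β₂ : ℝ)
    (𝒳 : Set (Fin d → ℝ)) (T : ℕ) (L : ℕ → (Fin d → ℝ) → ℝ)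
    (x g : ℕ → Fin d → ℝ) (M H : ℕ → Matrix (Fin d) (Fin d) ℝ) : Prop :=
  x 1 ∈ 𝒳 ∧ M 0 = ε • (1 : Matrix (Fin d) (Fin d) ℝ) ∧
  ∀ t, 1 ≤ t → t ≤ T →
    Differentiable ℝ (L t) ∧ ConvexOn ℝ Set.univ (L t) ∧
    g t = grad (L t) (x t) ∧
    M t = β₂ • M (t - 1) + Matrix.vecMulVec (g t) (g t) ∧
    H t ∈ 𝓗 ∧ (H t).PosDef ∧
    (∀ H' ∈ 𝓗, H'.PosDef →
      minner (M t) (H t)⁻¹ + η ^ 2 * (H t).trace ≤ minner (M t) H'⁻¹ + η ^ 2 * H'.trace) ∧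
    x (t + 1) ∈ 𝒳 ∧
    (∀ y ∈ 𝒳,
      (x (t + 1) - (x t - (H t)⁻¹.mulVec (g t))) ⬝ᵥ
          (H t).mulVec (x (t + 1) - (x t - (H t)⁻¹.mulVec (g t))) ≤
      (y - (x t - (H t)⁻¹.mulVec (g t))) ⬝ᵥ
          (H t).mulVec (y - (x t - (H t)⁻¹.mulVec (g t))))

theorem WellStructured.exists_subalgebra {d : ℕ} {𝓗 : Set (Matrix (Fin d) (Fin d) ℝ)}
    (h𝓗 : WellStructured 𝓗) :
    ∃ K : Subalgebra ℝ (Matrix (Fin d) (Fin d) ℝ), ∀ A, A ∈ 𝓗 ↔ A ∈ K ∧ A.PosSemidef := by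
  obtain ⟨K, ⟨hsmul, hadd, hmul, hone⟩, rfl⟩ := h𝓗
  refine ⟨{ carrier := K
            mul_mem' := fun ha hb => hmul _ ha _ hb
            add_mem' := fun ha hb => hadd _ ha _ hb
            algebraMap_mem' := fun r => ?_ }, fun A => Iff.rfl⟩
  rw [Algebra.algebraMap_eq_smul_one]
  exact hsmul r _ hone

theorem Subalgebra.matrix_inv_mem {n : Type*} [Fintype n] [DecidableEq n]
    (K : Subalgebra ℝ (Matrix n n ℝ)) {A : Matrix n n ℝ} (hA : A ∈ K) (hu : IsUnit A) :
    A⁻¹ ∈ K := by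
  have hdet : IsUnit A.det := (Matrix.isUnit_iff_isUnit_det A).mp hu
  have hinj : Function.Injective (LinearMap.mulLeft ℝ (⟨A, hA⟩ : K)) := by
    intro B C h
    have h' : A * (B : Matrix n n ℝ) = A * C := congrArg Subtype.val h
    exact Subtype.ext (hu.mul_left_cancel h')
  obtain ⟨B, hB⟩ := LinearMap.surjective_of_injective hinj 1
  have hB' : A * (B : Matrix n n ℝ) = 1 := congrArg Subtype.val hB
  rw [Matrix.inv_eq_right_inv hB']
  exact B.2

open scoped MatrixOrder in
theorem Matrix.PosSemidef.trace_mul_nonneg {n : Type*} [Fintype n] [DecidableEq n]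
    {A B : Matrix n n ℝ} (hA : A.PosSemidef) (hB : B.PosSemidef) : 0 ≤ (A * B).trace := by
  obtain ⟨C, rfl⟩ := CStarAlgebra.nonneg_iff_eq_star_mul_self.mp hB.nonneg
  rw [← Matrix.mul_assoc, Matrix.trace_mul_comm, ← Matrix.mul_assoc]
  exact (hA.mul_mul_conjTranspose_same C).trace_nonneg

theorem minner_nonneg {n : Type*} [Fintype n] [DecidableEq n] {A B : Matrix n n ℝ}
    (hA : A.PosSemidef) (hB : B.PosSemidef) : 0 ≤ minner A B :=
  hA.transpose.trace_mul_nonneg hB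

theorem minner_vecMulVec {n : Type*} [Fintype n] (g : n → ℝ) (A : Matrix n n ℝ) :
    minner (Matrix.vecMulVec g g) A = g ⬝ᵥ A.mulVec g := by
  rw [minner, Matrix.transpose_vecMulVec, Matrix.vecMulVec_mul, Matrix.trace_vecMulVec,
    dotProduct_mulVec, dotProduct_comm]

/-- A differentiable function on the line that is minimal at `0` over `[0, 1]` has nonnegative
derivative there. -/
theorem HasDerivAt.nonneg_of_forall_Icc_le {f : ℝ → ℝ} {f' : ℝ} (hf : HasDerivAt f f' 0)
    (hmin : ∀ s ∈ Set.Icc (0 : ℝ) 1, f 0 ≤ f s) : 0 ≤ f' := by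
  have h := (hasDerivWithinAt_iff_tendsto_slope' (s := Set.Ioi 0) (by simp)).mp
    hf.hasDerivWithinAt
  refine ge_of_tendsto h ?_
  filter_upwards [Ioc_mem_nhdsGT (zero_lt_one' ℝ)] with s hs
  rw [slope_def_field, sub_zero]
  exact div_nonneg (sub_nonneg.mpr (hmin s ⟨hs.1.le, hs.2⟩)) hs.1.le

theorem ConvexOn.sub_le_grad_dotProduct {d : ℕ} {f : (Fin d → ℝ) → ℝ}
    (hf : Differentiable ℝ f) (hc : ConvexOn ℝ Set.univ f) (x y : Fin d → ℝ) :
    f x - f y ≤ grad f x ⬝ᵥ (x - y) := by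
  have hgrad : grad f x ⬝ᵥ (x - y) = fderiv ℝ f x (x - y) := by
    conv_rhs => rw [pi_eq_sum_univ' (x - y)]
    simp only [map_sum, map_smul, smul_eq_mul, dotProduct, grad]
    refine Finset.sum_congr rfl fun i _ => ?_
    rw [mul_comm]
  have hline : HasDerivAt (fun s : ℝ => x + s • (y - x)) (y - x) 0 := by
    simpa using ((hasDerivAt_id (0 : ℝ)).smul_const (y - x)).const_add x
  have hfx : HasFDerivAt f (fderiv ℝ f x) (x + (0 : ℝ) • (y - x)) := by
    simpa using (hf x).hasFDerivAt
  have hcomp := hfx.comp_hasDerivAt (0 : ℝ) hline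
  have hlin : HasDerivAt (fun s : ℝ => f x + s * (f y - f x)) (f y - f x) 0 := by
    simpa using ((hasDerivAt_id (0 : ℝ)).mul_const (f y - f x)).const_add (f x)
  have h := (hlin.sub hcomp).nonneg_of_forall_Icc_le ?_
  · rw [hgrad, ← neg_sub y x, map_neg]
    linarith
  · intro s hs
    have := hc.2 (Set.mem_univ x) (Set.mem_univ y) (sub_nonneg.mpr hs.2) hs.1 (by ring)
    have he : (1 - s) • x + s • y = x + s • (y - x) := by module
    rw [he] at this
    simp only [smul_eq_mul] at this
    simp only [Pi.sub_apply, Function.comp_apply, zero_smul, add_zero, zero_mul, sub_self]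
    linarith

section InverseDerivative

attribute [local instance] Matrix.linftyOpNormedRing Matrix.linftyOpNormedAlgebra

theorem Matrix.hasDerivAt_trace_mul_inv_add_smul {n : Type*} [Fintype n] [DecidableEq n]
    (Q N X : Matrix n n ℝ) (hN : IsUnit N) :
    HasDerivAt (fun s : ℝ => (Q * (N + s • X)⁻¹).trace) (-(Q * (N⁻¹ * X * N⁻¹)).trace) 0 := by
  obtain ⟨u, rfl⟩ := hN
  have hline : HasDerivAt (fun s : ℝ => (u : Matrix n n ℝ) + s • X) X 0 := by
    have h := ((hasDerivAt_id (0 : ℝ)).smul_const X).const_add (u : Matrix n n ℝ)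
    rwa [one_smul] at h
  have hinv := hasFDerivAt_ringInverse (𝕜 := ℝ) u
  rw [show (u : Matrix n n ℝ) = u + (0 : ℝ) • X by simp] at hinv
  have hcomp := hinv.comp_hasDerivAt (0 : ℝ) hline
  let φ : Matrix n n ℝ →L[ℝ] ℝ :=
    LinearMap.toContinuousLinearMap
      ((Matrix.traceLinearMap n ℝ ℝ).comp (LinearMap.mulLeft ℝ Q))
  have h := φ.hasFDerivAt.comp_hasDerivAt (0 : ℝ) hcomp
  refine (h.congr_deriv ?_).congr_of_eventuallyEq (Filter.Eventually.of_forall fun s => ?_)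
  · change (Q * -(((u⁻¹ : (Matrix n n ℝ)ˣ) : Matrix n n ℝ) * X * _)).trace = _
    rw [Matrix.coe_units_inv, Matrix.mul_neg, Matrix.trace_neg]
  · beta_reduce
    rw [Matrix.nonsing_inv_eq_ringInverse]
    rfl

end InverseDerivative

section Minimizer

variable {d : ℕ} {𝓗 : Set (Matrix (Fin d) (Fin d) ℝ)} {η : ℝ}
  {M H : Matrix (Fin d) (Fin d) ℝ}

theorem WellStructured.smul_mem (h𝓗 : WellStructured 𝓗) {A : Matrix (Fin d) (Fin d) ℝ}
    (hA : A ∈ 𝓗) {c : ℝ} (hc : 0 ≤ c) : c • A ∈ 𝓗 := by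
  obtain ⟨K, hK⟩ := h𝓗.exists_subalgebra
  exact (hK _).mpr ⟨K.smul_mem ((hK A).mp hA).1 c, ((hK A).mp hA).2.smul hc⟩

theorem WellStructured.inv_mem (h𝓗 : WellStructured 𝓗) {A : Matrix (Fin d) (Fin d) ℝ}
    (hA : A ∈ 𝓗) (hA' : A.PosDef) : A⁻¹ ∈ 𝓗 := by
  obtain ⟨K, hK⟩ := h𝓗.exists_subalgebra
  exact (hK _).mpr ⟨K.matrix_inv_mem ((hK A).mp hA).1 hA'.isUnit, hA'.inv.posSemidef⟩

theorem WellStructured.add_mem (h𝓗 : WellStructured 𝓗) {A B : Matrix (Fin d) (Fin d) ℝ}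
    (hA : A ∈ 𝓗) (hB : B ∈ 𝓗) : A + B ∈ 𝓗 := by
  obtain ⟨K, hK⟩ := h𝓗.exists_subalgebra
  exact (hK _).mpr ⟨K.add_mem ((hK A).mp hA).1 ((hK B).mp hB).1,
    ((hK A).mp hA).2.add ((hK B).mp hB).2⟩

theorem WellStructured.posSemidef (h𝓗 : WellStructured 𝓗) {A : Matrix (Fin d) (Fin d) ℝ}
    (hA : A ∈ 𝓗) : A.PosSemidef := by
  obtain ⟨K, hK⟩ := h𝓗.exists_subalgebra
  exact ((hK A).mp hA).2

theorem WellStructured.mul_mul_same_mem (h𝓗 : WellStructured 𝓗)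
    {A B : Matrix (Fin d) (Fin d) ℝ} (hA : A ∈ 𝓗) (hB : B ∈ 𝓗) : A * B * A ∈ 𝓗 := by
  obtain ⟨K, hK⟩ := h𝓗.exists_subalgebra
  refine (hK _).mpr ⟨K.mul_mem (K.mul_mem ((hK A).mp hA).1 ((hK B).mp hB).1)
    ((hK A).mp hA).1, ?_⟩
  have h := ((hK B).mp hB).2.mul_mul_conjTranspose_same A
  rwa [((hK A).mp hA).2.isHermitian.eq] at h

/-- One half of the first-order condition for the preconditioner, obtained by perturbing `H⁻¹` to
`H⁻¹ + s • Y`. -/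
theorem WellStructured.trace_mul_mul_le_minner (h𝓗 : WellStructured 𝓗) (hH : H ∈ 𝓗)
    (hHpd : H.PosDef)
    (hmin : ∀ H' ∈ 𝓗, H'.PosDef →
      minner M H⁻¹ + η ^ 2 * H.trace ≤ minner M H'⁻¹ + η ^ 2 * H'.trace)
    {Y : Matrix (Fin d) (Fin d) ℝ} (hY : Y ∈ 𝓗) :
    η ^ 2 * (H * Y * H).trace ≤ minner M Y := by
  have hu : IsUnit H.det := (Matrix.isUnit_iff_isUnit_det H).mp hHpd.isUnit
  have hder : HasDerivAt (fun s : ℝ => minner M H⁻¹ + s * minner M Y +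
      η ^ 2 * (1 * (H⁻¹ + s • Y)⁻¹).trace)
      (minner M Y + η ^ 2 * -(1 * (H⁻¹⁻¹ * Y * H⁻¹⁻¹)).trace) 0 := by
    have hlin : HasDerivAt (fun s : ℝ => minner M H⁻¹ + s * minner M Y) (minner M Y) 0 := by
      simpa using ((hasDerivAt_id (0 : ℝ)).mul_const (minner M Y)).const_add (minner M H⁻¹)
    exact hlin.add
      ((Matrix.hasDerivAt_trace_mul_inv_add_smul 1 H⁻¹ Y hHpd.inv.isUnit).const_mul _)
  have h := hder.nonneg_of_forall_Icc_le ?_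
  · rw [Matrix.nonsing_inv_nonsing_inv _ hu, Matrix.one_mul] at h
    linarith
  · intro s hs
    have hN : H⁻¹ + s • Y ∈ 𝓗 := h𝓗.add_mem (h𝓗.inv_mem hH hHpd) (h𝓗.smul_mem hY hs.1)
    have hNpd : (H⁻¹ + s • Y).PosDef :=
      hHpd.inv.add_posSemidef ((h𝓗.posSemidef hY).smul hs.1)
    have h := hmin _ (h𝓗.inv_mem hN hNpd) hNpd.inv
    rw [Matrix.nonsing_inv_nonsing_inv _ ((Matrix.isUnit_iff_isUnit_det _).mp hNpd.isUnit)] at h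
    have he : minner M (H⁻¹ + s • Y) = minner M H⁻¹ + s * minner M Y := by
      simp [minner, Matrix.mul_add]
    rw [he] at h
    simpa [Matrix.nonsing_inv_nonsing_inv _ hu] using h

/-- The other half of the first-order condition for the preconditioner, obtained by perturbing `H`
to `H + s • (H * Y * H)`. -/
theorem WellStructured.minner_le_trace_mul_mul (h𝓗 : WellStructured 𝓗) (hH : H ∈ 𝓗)
    (hHpd : H.PosDef)
    (hmin : ∀ H' ∈ 𝓗, H'.PosDef →
      minner M H⁻¹ + η ^ 2 * H.trace ≤ minner M H'⁻¹ + η ^ 2 * H'.trace)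
    {Y : Matrix (Fin d) (Fin d) ℝ} (hY : Y ∈ 𝓗) :
    minner M Y ≤ η ^ 2 * (H * Y * H).trace := by
  have hu : IsUnit H.det := (Matrix.isUnit_iff_isUnit_det H).mp hHpd.isUnit
  have hX := h𝓗.mul_mul_same_mem hH hY
  have hder : HasDerivAt (fun s : ℝ => (Mᵀ * (H + s • (H * Y * H))⁻¹).trace +
      (η ^ 2 * H.trace + s * (η ^ 2 * (H * Y * H).trace)))
      (-(Mᵀ * (H⁻¹ * (H * Y * H) * H⁻¹)).trace + η ^ 2 * (H * Y * H).trace) 0 := by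
    refine (Matrix.hasDerivAt_trace_mul_inv_add_smul Mᵀ H (H * Y * H) hHpd.isUnit).add ?_
    simpa using ((hasDerivAt_id (0 : ℝ)).mul_const (η ^ 2 * (H * Y * H).trace)).const_add
      (η ^ 2 * H.trace)
  have h := hder.nonneg_of_forall_Icc_le ?_
  · have he : H⁻¹ * (H * Y * H) * H⁻¹ = Y := by
      rw [Matrix.mul_assoc H, Matrix.nonsing_inv_mul_cancel_left _ _ hu,
        Matrix.mul_nonsing_inv_cancel_right _ _ hu]
    rw [he] at h
    rw [minner]
    linarith
  · intro s hs
    have h := hmin _ (h𝓗.add_mem hH (h𝓗.smul_mem hX hs.1))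
      (hHpd.add_posSemidef ((h𝓗.posSemidef hX).smul hs.1))
    simp only [minner, Matrix.trace_add, Matrix.trace_smul, smul_eq_mul] at h
    simp only [zero_smul, add_zero, zero_mul]
    linarith

end Minimizer

theorem Matrix.PosDef.trace_conjTranspose_mul_mul_pos {n : Type*} [Fintype n] [DecidableEq n]
    {Q P : Matrix n n ℝ} (hQ : Q.PosDef) (hP : P ≠ 0) : 0 < (Pᴴ * Q * P).trace := by
  have hps := hQ.posSemidef.conjTranspose_mul_mul_same P
  refine lt_of_le_of_ne hps.trace_nonneg fun h0 => hP ?_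
  have hz := hps.trace_eq_zero_iff.mp h0.symm
  ext i j
  by_contra hij
  have hcol : P.mulVec (Pi.single j 1) ≠ 0 := fun h => hij <| by
    simpa using congrFun h i
  have hpos := hQ.dotProduct_mulVec_pos hcol
  have hcalc : star (P.mulVec (Pi.single j 1)) ⬝ᵥ Q.mulVec (P.mulVec (Pi.single j 1)) =
      Pi.single j 1 ⬝ᵥ (Pᴴ * Q * P).mulVec (Pi.single j 1) := by
    rw [Matrix.star_mulVec, ← Matrix.dotProduct_mulVec, Matrix.mulVec_mulVec,
      Matrix.mulVec_mulVec]
    simp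
  rw [hcalc, hz] at hpos
  simp at hpos

/-- A real symmetric matrix that is not positive semidefinite has a nonzero polynomial image on
which it acts as a negative scalar. -/
theorem Matrix.IsHermitian.exists_aeval_ne_zero_of_not_posSemidef {n : Type*} [Fintype n]
    [DecidableEq n] {C : Matrix n n ℝ} (hC : C.IsHermitian) (hneg : ¬ C.PosSemidef) :
    ∃ μ < (0 : ℝ), ∃ p : Polynomial ℝ,
      Polynomial.aeval C p ≠ 0 ∧ C * Polynomial.aeval C p = μ • Polynomial.aeval C p := by
  rw [hC.posSemidef_iff_eigenvalues_nonneg, Pi.le_def] at hneg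
  push Not at hneg
  obtain ⟨i, hi⟩ := hneg
  refine ⟨hC.eigenvalues i, hi, ?_⟩
  have heig : Module.End.HasEigenvalue (Matrix.toLin' C) (hC.eigenvalues i) := by
    rw [Module.End.hasEigenvalue_iff_mem_spectrum, Matrix.spectrum_toLin']
    exact hC.eigenvalues_mem_spectrum_real i
  have hroot := Module.End.isRoot_of_hasEigenvalue heig
  rw [Matrix.minpoly_toLin'] at hroot
  obtain ⟨q, hq⟩ := Polynomial.dvd_iff_isRoot.mpr hroot
  have hint : IsIntegral ℝ C := Algebra.IsIntegral.isIntegral C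
  have hq0 : q ≠ 0 := by
    rintro rfl
    exact minpoly.ne_zero hint (by simpa using hq)
  refine ⟨q, fun h0 => ?_, ?_⟩
  · have hle := minpoly.degree_le_of_ne_zero ℝ C hq0 h0
    rw [hq, Polynomial.degree_mul, Polynomial.degree_X_sub_C,
      Polynomial.degree_eq_natDegree hq0] at hle
    norm_cast at hle
    omega
  · have h0 := minpoly.aeval ℝ C
    rw [hq, map_mul, map_sub, Polynomial.aeval_X, Polynomial.aeval_C, sub_mul, sub_eq_zero] at h0
    rw [h0, Algebra.smul_def]

theorem Matrix.IsHermitian.aeval {n : Type*} [Fintype n] [DecidableEq n] {C : Matrix n n ℝ}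
    (hC : C.IsHermitian) (p : Polynomial ℝ) : (Polynomial.aeval C p).IsHermitian := by
  induction p using Polynomial.induction_on' with
  | add p q hp hq => rw [map_add]; exact hp.add hq
  | monomial k a =>
    rw [Polynomial.aeval_monomial, ← Algebra.smul_def]
    exact (hC.pow k).smul (IsSelfAdjoint.all a)

/-- A form of operator monotonicity of the square root inside a well-structured set. -/
theorem WellStructured.sub_mem {d : ℕ} {𝓗 : Set (Matrix (Fin d) (Fin d) ℝ)}
    (h𝓗 : WellStructured 𝓗) {A B : Matrix (Fin d) (Fin d) ℝ} (hA : A ∈ 𝓗) (hApd : A.PosDef)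
    (hB : B ∈ 𝓗) (hsq : ∀ Y ∈ 𝓗, (B * Y * B).trace ≤ (A * Y * A).trace) : A - B ∈ 𝓗 := by
  obtain ⟨K, hK⟩ := h𝓗.exists_subalgebra
  obtain ⟨hAK, hAps⟩ := (hK A).mp hA
  obtain ⟨hBK, hBps⟩ := (hK B).mp hB
  have hCK : A - B ∈ K := K.sub_mem hAK hBK
  refine (hK _).mpr ⟨hCK, ?_⟩
  by_contra hneg
  have hC : (A - B).IsHermitian := hAps.isHermitian.sub hBps.isHermitian
  obtain ⟨μ, hμ, p, hP0, hCP⟩ := hC.exists_aeval_ne_zero_of_not_posSemidef hneg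
  have hPK : Polynomial.aeval (A - B) p ∈ K :=
    Algebra.adjoin_le (S := K) (by simpa using hCK)
      (Polynomial.aeval_mem_adjoin_singleton ℝ (A - B))
  have hPC : Polynomial.aeval (A - B) p * (A - B) = μ • Polynomial.aeval (A - B) p := by
    rw [← hCP]
    simpa using congrArg (Polynomial.aeval (A - B)) (mul_comm p Polynomial.X)
  have hPh := hC.aeval p
  generalize Polynomial.aeval (A - B) p = P at *
  have hY : P * P ∈ 𝓗 := by
    refine (hK _).mpr ⟨K.mul_mem hPK hPK, ?_⟩
    have h := Matrix.posSemidef_conjTranspose_mul_self P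
    rwa [hPh.eq] at h
  have hpos := (hApd.add_posSemidef hBps).trace_conjTranspose_mul_mul_pos hP0
  rw [hPh.eq] at hpos
  have hkey : (A * (P * P) * A).trace - (B * (P * P) * B).trace =
      μ * (P * (A + B) * P).trace := by
    have h1 : (A * (P * P) * A).trace = (P * (A * A) * P).trace := by
      rw [Matrix.trace_mul_comm, ← Matrix.mul_assoc, ← Matrix.mul_assoc, Matrix.trace_mul_comm,
        ← Matrix.mul_assoc]
    have h2 : (B * (P * P) * B).trace = (P * (B * B) * P).trace := by
      rw [Matrix.trace_mul_comm, ← Matrix.mul_assoc, ← Matrix.mul_assoc, Matrix.trace_mul_comm,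
        ← Matrix.mul_assoc]
    have h3 : P * (A * A) * P - P * (B * B) * P =
        P * A * ((A - B) * P) + P * (A - B) * (B * P) := by
      noncomm_ring
    rw [h1, h2, ← Matrix.trace_sub, h3, hCP, hPC, Matrix.mul_add, Matrix.add_mul,
      Matrix.trace_add, Matrix.trace_add]
    simp [Matrix.mul_assoc, mul_add]
  have := hsq _ hY
  nlinarith

theorem Matrix.PosSemidef.dotProduct_mulVec_le_trace_mul {n : Type*} [Fintype n] [DecidableEq n]
    {A : Matrix n n ℝ} (hA : A.PosSemidef) (x : n → ℝ) :
    x ⬝ᵥ A.mulVec x ≤ A.trace * (x ⬝ᵥ x) := by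
  have hps : ((x ⬝ᵥ x) • (1 : Matrix n n ℝ) - Matrix.vecMulVec x x).PosSemidef := by
    refine .of_dotProduct_mulVec_nonneg ?_ fun y => ?_
    · refine (Matrix.isHermitian_one.smul (IsSelfAdjoint.all _)).sub ?_
      simpa using (Matrix.posSemidef_vecMulVec_self_star x).isHermitian
    · have hcs := Finset.sum_mul_sq_le_sq_mul_sq Finset.univ x y
      simp only [star_trivial, Matrix.sub_mulVec, Matrix.smul_mulVec, Matrix.one_mulVec,
        Matrix.vecMulVec_mulVec, dotProduct_sub, dotProduct_smul, smul_eq_mul]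
      simp only [dotProduct, MulOpposite.smul_eq_mul_unop, MulOpposite.unop_op] at *
      simp only [← pow_two, mul_comm (y _)]
      nlinarith
  have h := hA.trace_mul_nonneg hps
  have hv : (A * Matrix.vecMulVec x x).trace = x ⬝ᵥ A.mulVec x := by
    rw [Matrix.mul_vecMulVec, Matrix.trace_vecMulVec, dotProduct_comm]
  rw [Matrix.mul_sub, Matrix.trace_sub, hv, Matrix.mul_smul, Matrix.trace_smul, Matrix.mul_one,
    smul_eq_mul] at h
  linarith

theorem bddAbove_hNorm {d : ℕ} {𝓗 : Set (Matrix (Fin d) (Fin d) ℝ)} (h𝓗 : WellStructured 𝓗)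
    (x : Fin d → ℝ) :
    BddAbove {r | ∃ H ∈ 𝓗, H.trace ≤ 1 ∧ r = Real.sqrt (x ⬝ᵥ H.mulVec x)} := by
  refine ⟨Real.sqrt (x ⬝ᵥ x), ?_⟩
  rintro r ⟨H, hH, htr, rfl⟩
  refine Real.sqrt_le_sqrt (((h𝓗.posSemidef hH).dotProduct_mulVec_le_trace_mul x).trans ?_)
  have : 0 ≤ x ⬝ᵥ x := by simpa using dotProduct_star_self_nonneg x
  nlinarith

theorem hNorm_nonneg {d : ℕ} (𝓗 : Set (Matrix (Fin d) (Fin d) ℝ)) (x : Fin d → ℝ) :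
    0 ≤ hNorm 𝓗 x := by
  refine Real.sSup_nonneg ?_
  rintro r ⟨H, -, -, rfl⟩
  exact Real.sqrt_nonneg _

theorem WellStructured.dotProduct_mulVec_le_hNorm_sq {d : ℕ}
    {𝓗 : Set (Matrix (Fin d) (Fin d) ℝ)} (h𝓗 : WellStructured 𝓗)
    {H : Matrix (Fin d) (Fin d) ℝ} (hH : H ∈ 𝓗) (x : Fin d → ℝ) :
    x ⬝ᵥ H.mulVec x ≤ hNorm 𝓗 x ^ 2 * H.trace := by
  have hps := h𝓗.posSemidef hH
  rcases hps.trace_nonneg.eq_or_lt with h0 | hpos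
  · rw [hps.trace_eq_zero_iff.mp h0.symm]
    simp
  · have hle : Real.sqrt (x ⬝ᵥ (H.trace⁻¹ • H).mulVec x) ≤ hNorm 𝓗 x :=
      le_csSup (bddAbove_hNorm h𝓗 x)
        ⟨_, h𝓗.smul_mem hH (inv_nonneg.mpr hpos.le), by simp [hpos.ne'], rfl⟩
    have h := (Real.sqrt_le_left (hNorm_nonneg 𝓗 x)).mp hle
    rw [Matrix.smul_mulVec, dotProduct_smul, smul_eq_mul, inv_mul_le_iff₀ hpos] at h
    linarith

theorem Matrix.IsHermitian.dotProduct_mulVec_comm {n : Type*} [Fintype n] {A : Matrix n n ℝ}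
    (hA : A.IsHermitian) (u v : n → ℝ) : u ⬝ᵥ A.mulVec v = v ⬝ᵥ A.mulVec u := by
  have hT : Aᵀ = A := by simpa using hA.eq
  rw [dotProduct_mulVec, ← Matrix.mulVec_transpose, hT, dotProduct_comm]

/-- The regret of one projected step with preconditioner `H`. -/
theorem dotProduct_sub_le_of_projected_step {n : Type*} [Fintype n] [DecidableEq n]
    {H : Matrix n n ℝ} (hH : H.PosDef) {𝒳 : Set (n → ℝ)} (h𝒳 : Convex ℝ 𝒳)
    {x x' g y : n → ℝ} (hx' : x' ∈ 𝒳) (hy : y ∈ 𝒳)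
    (hmin : ∀ z ∈ 𝒳, (x' - (x - H⁻¹.mulVec g)) ⬝ᵥ H.mulVec (x' - (x - H⁻¹.mulVec g)) ≤
      (z - (x - H⁻¹.mulVec g)) ⬝ᵥ H.mulVec (z - (x - H⁻¹.mulVec g))) :
    g ⬝ᵥ (x - y) ≤ (g ⬝ᵥ H⁻¹.mulVec g + (x - y) ⬝ᵥ H.mulVec (x - y) -
      (x' - y) ⬝ᵥ H.mulVec (x' - y)) / 2 := by
  have hu : IsUnit H.det := (Matrix.isUnit_iff_isUnit_det H).mp hH.isUnit
  have hexp : ∀ u v : n → ℝ, ∀ s : ℝ, (u + s • v) ⬝ᵥ H.mulVec (u + s • v) =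
      u ⬝ᵥ H.mulVec u + 2 * s * (u ⬝ᵥ H.mulVec v) + s ^ 2 * (v ⬝ᵥ H.mulVec v) := by
    intro u v s
    simp only [Matrix.mulVec_add, Matrix.mulVec_smul, dotProduct_add, add_dotProduct,
      dotProduct_smul, smul_dotProduct, smul_eq_mul]
    rw [hH.isHermitian.dotProduct_mulVec_comm v u]
    ring
  have hHw : H.mulVec (H⁻¹.mulVec g) = g := by
    rw [Matrix.mulVec_mulVec, Matrix.mul_nonsing_inv _ hu, Matrix.one_mulVec]
  set w := H⁻¹.mulVec g
  have hvar : 0 ≤ 2 * ((x' - (x - w)) ⬝ᵥ H.mulVec (y - x')) := by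
    have hder : HasDerivAt (fun s : ℝ => (x' - (x - w)) ⬝ᵥ H.mulVec (x' - (x - w)) +
        2 * s * ((x' - (x - w)) ⬝ᵥ H.mulVec (y - x')) +
        s ^ 2 * ((y - x') ⬝ᵥ H.mulVec (y - x')))
        (2 * ((x' - (x - w)) ⬝ᵥ H.mulVec (y - x'))) 0 := by
      have h1 := (((hasDerivAt_id (0 : ℝ)).const_mul 2).mul_const
        ((x' - (x - w)) ⬝ᵥ H.mulVec (y - x'))).const_add
        ((x' - (x - w)) ⬝ᵥ H.mulVec (x' - (x - w)))
      have h2 := ((hasDerivAt_id (0 : ℝ)).pow 2).mul_const ((y - x') ⬝ᵥ H.mulVec (y - x'))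
      exact (h1.add h2).congr_deriv (by simp)
    refine hder.nonneg_of_forall_Icc_le fun s hs => ?_
    have hz : x' + s • (y - x') ∈ 𝒳 := h𝒳.add_smul_sub_mem hx' hy hs
    have h := hmin _ hz
    rw [show x' + s • (y - x') - (x - w) = x' - (x - w) + s • (y - x') by abel, hexp] at h
    simpa using h
  have hpyth := hexp (x' - (x - w)) (y - x') 1
  have hdist := hexp w (x - y) (-1)
  rw [show x' - (x - w) + (1 : ℝ) • (y - x') = w + (-1 : ℝ) • (x - y) by module, hdist,
    hH.isHermitian.dotProduct_mulVec_comm w (x - y), hHw, dotProduct_comm w g,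
    dotProduct_comm (x - y) g] at hpyth
  have hnonneg : 0 ≤ (x' - (x - w)) ⬝ᵥ H.mulVec (x' - (x - w)) := by
    simpa using hH.posSemidef.dotProduct_mulVec_nonneg (x' - (x - w))
  have hsymm : (y - x') ⬝ᵥ H.mulVec (y - x') = (x' - y) ⬝ᵥ H.mulVec (x' - y) := by
    rw [← neg_sub x' y, Matrix.mulVec_neg, neg_dotProduct_neg]
  rw [hsymm] at hpyth
  linarith

theorem WeightedAdaReg.posSemidef {d : ℕ} {𝓗 : Set (Matrix (Fin d) (Fin d) ℝ)}
    {ε η β₂ : ℝ} {𝒳 : Set (Fin d → ℝ)} {T : ℕ} {L : ℕ → (Fin d → ℝ) → ℝ}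
    {x g : ℕ → Fin d → ℝ} {M H : ℕ → Matrix (Fin d) (Fin d) ℝ}
    (hiter : WeightedAdaReg 𝓗 ε η β₂ 𝒳 T L x g M H) (hε : 0 ≤ ε) (hβ₂ : 0 ≤ β₂) :
    ∀ n ≤ T, (M n).PosSemidef := by
  intro n
  induction n with
  | zero =>
    intro _
    rw [hiter.2.1]
    exact Matrix.PosSemidef.one.smul hε
  | succ n ih =>
    intro hn
    rw [(hiter.2.2 (n + 1) (by omega) hn).2.2.2.1, Nat.add_sub_cancel]
    refine ((ih (by omega)).smul hβ₂).add ?_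
    simpa using Matrix.posSemidef_vecMulVec_self_star (g (n + 1))

theorem minner_smul_add_vecMulVec {n : Type*} [Fintype n] (c : ℝ) (M A : Matrix n n ℝ)
    (g : n → ℝ) :
    minner (c • M + Matrix.vecMulVec g g) A = c * minner M A + g ⬝ᵥ A.mulVec g := by
  rw [← minner_vecMulVec]
  simp [minner, Matrix.add_mul]

theorem Matrix.inv_smul_of_ne_zero {n : Type*} [Fintype n] [DecidableEq n] {c : ℝ} (hc : c ≠ 0)
    {A : Matrix n n ℝ} (hA : IsUnit A) : (c • A)⁻¹ = c⁻¹ • A⁻¹ :=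
  Matrix.inv_smul' A (Units.mk0 c hc) ((Matrix.isUnit_iff_isUnit_det A).mp hA)

/-- The discounted linearised regret bound in terms of the last preconditioner, with `b ^ 2` the
decay of the second moments. -/
theorem WeightedAdaReg.sum_dotProduct_le {d : ℕ} {𝓗 : Set (Matrix (Fin d) (Fin d) ℝ)}
    (h𝓗 : WellStructured 𝓗) {ε η b : ℝ} (hε : 0 ≤ ε) (hη : 0 < η) (hb : 0 < b)
    {𝒳 : Set (Fin d → ℝ)} (h𝒳 : Convex ℝ 𝒳) {T : ℕ} {L : ℕ → (Fin d → ℝ) → ℝ}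
    {x g : ℕ → Fin d → ℝ} {M H : ℕ → Matrix (Fin d) (Fin d) ℝ}
    (hiter : WeightedAdaReg 𝓗 ε η (b ^ 2) 𝒳 T L x g M H) {y : Fin d → ℝ} (hy : y ∈ 𝒳)
    {D : ℝ} (hD : ∀ t, 1 ≤ t → t ≤ T → hNorm 𝓗 (x t - y) ≤ D) {n : ℕ} (hn : 1 ≤ n) :
    n ≤ T → ∑ t ∈ Finset.Icc 1 n, b ^ (n - t) * (g t ⬝ᵥ (x t - y)) ≤
      (minner (M n) (H n)⁻¹ + η ^ 2 * (H n).trace + D ^ 2 * (H n).trace -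
        (x (n + 1) - y) ⬝ᵥ (H n).mulVec (x (n + 1) - y)) / 2 := by
  have hquad : ∀ t, 1 ≤ t → t ≤ T → ∀ A ∈ 𝓗,
      (x t - y) ⬝ᵥ A.mulVec (x t - y) ≤ D ^ 2 * A.trace := by
    intro t ht htT A hA
    refine (h𝓗.dotProduct_mulVec_le_hNorm_sq hA _).trans ?_
    have := (h𝓗.posSemidef hA).trace_nonneg
    have := hNorm_nonneg 𝓗 (x t - y)
    have := hD t ht htT
    gcongr
  have hps := hiter.posSemidef hε (sq_nonneg b)
  induction n, hn using Nat.le_induction with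
  | base =>
    intro h1T
    obtain ⟨-, -, -, hM, hH, hHpd, -, hx, hproj⟩ := hiter.2.2 1 le_rfl h1T
    have hstep := dotProduct_sub_le_of_projected_step hHpd h𝒳 hx hy hproj
    have hM0 : 0 ≤ b ^ 2 * minner (M (1 - 1)) (H 1)⁻¹ :=
      mul_nonneg (sq_nonneg b) (minner_nonneg (hps _ (by omega)) hHpd.inv.posSemidef)
    have htr : 0 ≤ η ^ 2 * (H 1).trace := mul_nonneg (sq_nonneg η) hHpd.posSemidef.trace_nonneg
    have hq := hquad 1 le_rfl h1T _ hH
    rw [hM, minner_smul_add_vecMulVec]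
    simp only [Finset.Icc_self, Finset.sum_singleton, Nat.sub_self, pow_zero, one_mul]
    linarith
  | succ n hn ih =>
    intro hnT
    have ih := ih (by omega)
    obtain ⟨-, -, -, -, hH, hHpd, hmin, -, -⟩ := hiter.2.2 n hn (by omega)
    obtain ⟨-, -, -, hM', hH', hHpd', hmin', hx', hproj'⟩ := hiter.2.2 (n + 1) (by omega) hnT
    rw [Nat.add_sub_cancel] at hM'
    have hstep := dotProduct_sub_le_of_projected_step hHpd' h𝒳 hx' hy hproj'
    have hmono : H (n + 1) - b • H n ∈ 𝓗 := by
      refine h𝓗.sub_mem hH' hHpd' (h𝓗.smul_mem hH hb.le) fun Y hY => ?_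
      have h1 := h𝓗.trace_mul_mul_le_minner hH hHpd hmin hY
      have h2 := h𝓗.minner_le_trace_mul_mul hH' hHpd' hmin' hY
      have h3 : 0 ≤ g (n + 1) ⬝ᵥ Y.mulVec (g (n + 1)) := by
        simpa using (h𝓗.posSemidef hY).dotProduct_mulVec_nonneg (g (n + 1))
      rw [hM', minner_smul_add_vecMulVec] at h2
      have h4 : (b • H n * Y * b • H n).trace = b ^ 2 * (H n * Y * H n).trace := by
        simp [pow_two, mul_assoc]
      rw [h4]
      refine le_of_mul_le_mul_left ?_ (pow_pos hη 2)
      have h5 := mul_le_mul_of_nonneg_left h1 (sq_nonneg b)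
      linarith
    have hq := hquad (n + 1) (by omega) hnT _ hmono
    rw [Matrix.sub_mulVec, dotProduct_sub, Matrix.smul_mulVec, dotProduct_smul, smul_eq_mul,
      Matrix.trace_sub, Matrix.trace_smul, smul_eq_mul] at hq
    have hcomp := hmin _ (h𝓗.smul_mem hH' (inv_nonneg.mpr hb.le))
      (hHpd'.smul (inv_pos.mpr hb))
    rw [Matrix.inv_smul_of_ne_zero (inv_ne_zero hb.ne') hHpd'.isUnit, inv_inv,
      Matrix.trace_smul, smul_eq_mul,
      show minner (M n) (b • (H (n + 1))⁻¹) = b * minner (M n) (H (n + 1))⁻¹ by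
        simp [minner]] at hcomp
    have hcomp' := mul_le_mul_of_nonneg_left hcomp hb.le
    have he : b * (b * minner (M n) (H (n + 1))⁻¹ + η ^ 2 * (b⁻¹ * (H (n + 1)).trace)) =
        b ^ 2 * minner (M n) (H (n + 1))⁻¹ + η ^ 2 * (H (n + 1)).trace := by
      field_simp
    rw [he] at hcomp'
    have ih' := mul_le_mul_of_nonneg_left ih hb.le
    have hsum : ∑ t ∈ Finset.Icc 1 (n + 1), b ^ (n + 1 - t) * (g t ⬝ᵥ (x t - y)) =
        b * ∑ t ∈ Finset.Icc 1 n, b ^ (n - t) * (g t ⬝ᵥ (x t - y)) +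
          g (n + 1) ⬝ᵥ (x (n + 1) - y) := by
      rw [Finset.sum_Icc_succ_top (by omega), Finset.mul_sum, Nat.sub_self, pow_zero, one_mul]
      congr 1
      refine Finset.sum_congr rfl fun t ht => ?_
      rw [Nat.succ_sub (Finset.mem_Icc.mp ht).2, pow_succ']
      ring
    rw [hsum, hM', minner_smul_add_vecMulVec]
    linarith

/-- The optimal value of the preconditioner objective is at most `2 η` times the objective over
trace-normalised preconditioners. -/
theorem WellStructured.minner_inv_add_trace_le {d : ℕ} {𝓗 : Set (Matrix (Fin d) (Fin d) ℝ)}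
    (h𝓗 : WellStructured 𝓗) {η : ℝ} (hη : 0 < η) {M H H' : Matrix (Fin d) (Fin d) ℝ}
    (hM : M.PosSemidef)
    (hmin : ∀ H' ∈ 𝓗, H'.PosDef →
      minner M H⁻¹ + η ^ 2 * H.trace ≤ minner M H'⁻¹ + η ^ 2 * H'.trace)
    (hH' : H' ∈ 𝓗) (hHpd' : H'.PosDef) (htr : H'.trace ≤ 1) :
    minner M H⁻¹ + η ^ 2 * H.trace ≤ 2 * η * Real.sqrt (minner M H'⁻¹) := by
  set a := Real.sqrt (minner M H'⁻¹)
  have ha : 0 ≤ a := Real.sqrt_nonneg _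
  have ha2 : minner M H'⁻¹ = a ^ 2 :=
    (Real.sq_sqrt (minner_nonneg hM hHpd'.inv.posSemidef)).symm
  refine le_of_forall_pos_le_add fun δ hδ => ?_
  have hδη : 0 < δ / η := div_pos hδ hη
  have hc : 0 < (a + δ / η) / η := by positivity
  have h := hmin _ (h𝓗.smul_mem hH' hc.le) (hHpd'.smul hc)
  rw [Matrix.inv_smul_of_ne_zero hc.ne' hHpd'.isUnit, Matrix.trace_smul, smul_eq_mul,
    show minner M (((a + δ / η) / η)⁻¹ • H'⁻¹) = ((a + δ / η) / η)⁻¹ * minner M H'⁻¹ by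
      simp [minner], ha2] at h
  have h1 : ((a + δ / η) / η)⁻¹ * a ^ 2 ≤ η * a := by
    rw [inv_mul_le_iff₀ hc]
    have : (a + δ / η) / η * (η * a) = (a + δ / η) * a := by field_simp
    rw [this]
    nlinarith [mul_nonneg hδη.le ha]
  have h2 : η ^ 2 * ((a + δ / η) / η * H'.trace) ≤ η * a + δ := by
    have : η ^ 2 * ((a + δ / η) / η * H'.trace) = (η * a + δ) * H'.trace := by field_simp
    rw [this]
    exact mul_le_of_le_one_right (by positivity) htr
  linarith

theorem stmt_10 {d : ℕ} (𝓗 : Set (Matrix (Fin d) (Fin d) ℝ)) (h𝓗 : WellStructured 𝓗)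
    (ε η β₂ : ℝ) (hε : 0 < ε) (hη : 0 < η) (hβ₂ : β₂ ∈ Set.Ioo (0 : ℝ) 1)
    (𝒳 : Set (Fin d → ℝ)) (h𝒳conv : Convex ℝ 𝒳) (h𝒳ne : 𝒳.Nonempty)
    (T : ℕ) (hT : 1 ≤ T) (L : ℕ → (Fin d → ℝ) → ℝ)
    (x g : ℕ → Fin d → ℝ) (M H : ℕ → Matrix (Fin d) (Fin d) ℝ)
    (hiter : WeightedAdaReg 𝓗 ε η β₂ 𝒳 T L x g M H) :
    ∀ xstar ∈ 𝒳, ∀ D : ℝ,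
      D = sSup {r | ∃ t, 1 ≤ t ∧ t ≤ T ∧ r = hNorm 𝓗 (x t - xstar)} →
      ∑ t ∈ Finset.Icc 1 T, β₂ ^ (((T - t : ℕ) : ℝ) / 2) * (L t (x t) - L t xstar) ≤
        (D ^ 2 / (2 * η) + η) *
          sInf {r | ∃ H' ∈ 𝓗, H'.PosDef ∧ H'.trace ≤ 1 ∧
            r = Real.sqrt (minner (M T) H'⁻¹)} := by
  intro y hy D hD
  have hb : 0 < Real.sqrt β₂ := Real.sqrt_pos.mpr hβ₂.1
  have hb2 : Real.sqrt β₂ ^ 2 = β₂ := Real.sq_sqrt hβ₂.1.le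
  have hps := hiter.posSemidef hε.le hβ₂.1.le
  obtain ⟨-, -, -, -, hH, hHpd, hmin, -, -⟩ := hiter.2.2 T hT le_rfl
  have hDle : ∀ t, 1 ≤ t → t ≤ T → hNorm 𝓗 (x t - y) ≤ D := by
    intro t ht htT
    rw [hD]
    refine le_csSup (Set.Finite.bddAbove ?_) ⟨t, ht, htT, rfl⟩
    refine ((Set.finite_Icc 1 T).image fun t => hNorm 𝓗 (x t - y)).subset ?_
    rintro r ⟨s, hs, hsT, rfl⟩
    exact ⟨s, ⟨hs, hsT⟩, rfl⟩
  have hreg := WeightedAdaReg.sum_dotProduct_le h𝓗 hε.le hη hb h𝒳conv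
    (by rwa [hb2]) hy hDle hT le_rfl
  have hlin : ∑ t ∈ Finset.Icc 1 T, β₂ ^ (((T - t : ℕ) : ℝ) / 2) * (L t (x t) - L t y) ≤
      ∑ t ∈ Finset.Icc 1 T, Real.sqrt β₂ ^ (T - t) * (g t ⬝ᵥ (x t - y)) := by
    refine Finset.sum_le_sum fun t ht => ?_
    obtain ⟨ht1, htT⟩ := Finset.mem_Icc.mp ht
    obtain ⟨hdiff, hconv, hg, -⟩ := hiter.2.2 t ht1 htT
    have hw : β₂ ^ (((T - t : ℕ) : ℝ) / 2) = Real.sqrt β₂ ^ (T - t) := by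
      rw [Real.sqrt_eq_rpow, ← Real.rpow_natCast, ← Real.rpow_mul hβ₂.1.le]
      congr 1
      ring
    rw [hw, hg]
    exact mul_le_mul_of_nonneg_left (hconv.sub_le_grad_dotProduct hdiff _ _) (by positivity)
  have hlast : 0 ≤ (x (T + 1) - y) ⬝ᵥ (H T).mulVec (x (T + 1) - y) := by
    simpa using hHpd.posSemidef.dotProduct_mulVec_nonneg (x (T + 1) - y)
  have htrace : η ^ 2 * (H T).trace ≤ minner (M T) (H T)⁻¹ := by
    have h := h𝓗.trace_mul_mul_le_minner hH hHpd hmin (h𝓗.inv_mem hH hHpd)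
    rwa [Matrix.mul_nonsing_inv _ ((Matrix.isUnit_iff_isUnit_det _).mp hHpd.isUnit),
      Matrix.one_mul] at h
  have hcoef : 0 < D ^ 2 / (2 * η) + η := by positivity
  rw [← div_le_iff₀' hcoef]
  refine le_csInf ?_ ?_
  · obtain ⟨K, hK⟩ := h𝓗.exists_subalgebra
    have hc : (0 : ℝ) < ((d : ℝ) + 1)⁻¹ := by positivity
    have hpd : (((d : ℝ) + 1)⁻¹ • (1 : Matrix (Fin d) (Fin d) ℝ)).PosDef :=
      Matrix.PosDef.one.smul hc
    refine ⟨_, _, (hK _).mpr ⟨K.smul_mem K.one_mem _, hpd.posSemidef⟩, hpd, ?_, rfl⟩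
    rw [Matrix.trace_smul, Matrix.trace_one, Fintype.card_fin, smul_eq_mul,
      inv_mul_le_iff₀ (by positivity)]
    linarith
  · rintro r ⟨H', hH', hHpd', htr', rfl⟩
    rw [div_le_iff₀' hcoef]
    have hval := h𝓗.minner_inv_add_trace_le hη (hps T le_rfl) hmin hH' hHpd' htr'
    set a := Real.sqrt (minner (M T) H'⁻¹)
    have hη_trace : (H T).trace ≤ a / η := by
      rw [le_div_iff₀ hη]
      refine le_of_mul_le_mul_left ?_ hη
      linarith
    have hDtrace := mul_le_mul_of_nonneg_left hη_trace (sq_nonneg D)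
    have he : (D ^ 2 / (2 * η) + η) * a = (2 * η * a + D ^ 2 * (a / η)) / 2 := by
      field_simp
      ring
    rw [he]
    linarith
end

section
/- Let d_L, d_R ≥ 1 and let X ∈ ℝ^{d_L×d_R}. Then sup{√(⟨X Xᵀ, H_L⟩) : H_L a symmetric positive semidefinite d_L×d_L real matrix with Tr(H_L) ≤ 1/d_R} = ‖X‖_op / √(d_R), where ‖X‖_op is the operator (spectral) norm of X. Equivalently, for the preconditioner set 𝓗 = {H_L ⊗ I_{d_R} : H_L ∈ S₊^{d_L}}, the 𝓗-norm of the vectorization of X equals ‖X‖_op / √(d_R). -/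
open Matrix Kronecker

/-- The operator (spectral) norm of a real matrix: the supremum of the Euclidean norm
`‖Xv‖₂` over vectors `v` in the Euclidean unit ball. -/
noncomputable def opNorm {m n : ℕ} (X : Matrix (Fin m) (Fin n) ℝ) : ℝ :=
  sSup {r | ∃ v : Fin n → ℝ, v ⬝ᵥ v ≤ 1 ∧ r = Real.sqrt (X.mulVec v ⬝ᵥ X.mulVec v)}

theorem dotProduct_sq_le {n : Type*} [Fintype n] (u v : n → ℝ) :
    (u ⬝ᵥ v) ^ 2 ≤ (u ⬝ᵥ u) * (v ⬝ᵥ v) := by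
  simpa [dotProduct, pow_two] using Finset.sum_mul_sq_le_sq_mul_sq Finset.univ u v

theorem dotProduct_self_nonneg_real {n : Type*} [Fintype n] (u : n → ℝ) : 0 ≤ u ⬝ᵥ u :=
  Finset.sum_nonneg fun i _ => mul_self_nonneg (u i)

theorem mulVec_dotProduct_self_le_frobenius {m n : Type*} [Fintype m] [Fintype n]
    (X : Matrix m n ℝ) (v : n → ℝ) :
    X.mulVec v ⬝ᵥ X.mulVec v ≤ (∑ i, X i ⬝ᵥ X i) * (v ⬝ᵥ v) := by
  rw [Finset.sum_mul]
  refine Finset.sum_le_sum fun i _ => ?_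
  rw [← pow_two]
  exact dotProduct_sq_le (X i) v

theorem opNorm_set_bddAbove {m n : ℕ} (X : Matrix (Fin m) (Fin n) ℝ) :
    BddAbove {r | ∃ v : Fin n → ℝ, v ⬝ᵥ v ≤ 1 ∧
      r = Real.sqrt (X.mulVec v ⬝ᵥ X.mulVec v)} := by
  refine ⟨Real.sqrt (∑ i, X i ⬝ᵥ X i), ?_⟩
  rintro _ ⟨v, hv, rfl⟩
  refine Real.sqrt_le_sqrt ((mulVec_dotProduct_self_le_frobenius X v).trans ?_)
  exact mul_le_of_le_one_right
    (Finset.sum_nonneg fun i _ => dotProduct_self_nonneg_real (X i)) hv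

theorem opNorm_nonneg {m n : ℕ} (X : Matrix (Fin m) (Fin n) ℝ) : 0 ≤ opNorm X := by
  refine Real.sSup_nonneg ?_
  rintro _ ⟨v, -, rfl⟩
  exact Real.sqrt_nonneg _

theorem mulVec_dotProduct_self_le {m n : ℕ} (X : Matrix (Fin m) (Fin n) ℝ) (v : Fin n → ℝ) :
    X.mulVec v ⬝ᵥ X.mulVec v ≤ opNorm X ^ 2 * (v ⬝ᵥ v) := by
  rcases (dotProduct_self_nonneg_real v).eq_or_lt with h | h
  · simpa [← h] using mulVec_dotProduct_self_le_frobenius X v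
  · set s := Real.sqrt (v ⬝ᵥ v)
    have hs0 : 0 < s := Real.sqrt_pos.2 h
    have hss : s ^ 2 = v ⬝ᵥ v := Real.sq_sqrt h.le
    have hle : Real.sqrt (X.mulVec (s⁻¹ • v) ⬝ᵥ X.mulVec (s⁻¹ • v)) ≤ opNorm X := by
      refine le_csSup (opNorm_set_bddAbove X) ⟨s⁻¹ • v, ?_, rfl⟩
      rw [smul_dotProduct, dotProduct_smul, ← hss, smul_eq_mul, smul_eq_mul]
      exact le_of_eq (by field_simp)
    rw [Real.sqrt_le_left (opNorm_nonneg X), mulVec_smul, smul_dotProduct, dotProduct_smul,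
      smul_eq_mul, smul_eq_mul] at hle
    rw [← hss]
    calc X.mulVec v ⬝ᵥ X.mulVec v
        = (s⁻¹ * (s⁻¹ * (X.mulVec v ⬝ᵥ X.mulVec v))) * s ^ 2 := by field_simp
      _ ≤ opNorm X ^ 2 * s ^ 2 := mul_le_mul_of_nonneg_right hle (sq_nonneg s)

theorem transpose_mulVec_dotProduct {m n : Type*} [Fintype m] [Fintype n]
    (X : Matrix m n ℝ) (w : m → ℝ) (v : n → ℝ) :
    Xᵀ.mulVec w ⬝ᵥ v = w ⬝ᵥ X.mulVec v := by
  rw [mulVec_transpose, dotProduct_mulVec]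

theorem transpose_mulVec_dotProduct_self_le {m n : ℕ} (X : Matrix (Fin m) (Fin n) ℝ)
    (w : Fin m → ℝ) :
    Xᵀ.mulVec w ⬝ᵥ Xᵀ.mulVec w ≤ opNorm X ^ 2 * (w ⬝ᵥ w) := by
  set u := Xᵀ.mulVec w
  rcases (dotProduct_self_nonneg_real u).eq_or_lt with h | h
  · rw [← h]
    exact mul_nonneg (sq_nonneg _) (dotProduct_self_nonneg_real w)
  · have h1 : u ⬝ᵥ u = w ⬝ᵥ X.mulVec u := transpose_mulVec_dotProduct X w u
    have h2 := dotProduct_sq_le w (X.mulVec u)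
    rw [← h1] at h2
    have h3 := mul_le_mul_of_nonneg_left (mulVec_dotProduct_self_le X u)
      (dotProduct_self_nonneg_real w)
    refine le_of_mul_le_mul_right ?_ h
    linarith

theorem minner_mul_transpose_vecMulVec {m n : Type*} [Fintype m] [Fintype n]
    (X : Matrix m n ℝ) (u : m → ℝ) :
    minner (X * Xᵀ) (vecMulVec u u) = Xᵀ.mulVec u ⬝ᵥ Xᵀ.mulVec u := by
  rw [minner, transpose_mul, transpose_transpose, mul_vecMulVec, trace_vecMulVec,
    transpose_mulVec_dotProduct, mulVec_mulVec, dotProduct_comm]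

theorem minner_mul_transpose_le {m n : ℕ} (X : Matrix (Fin m) (Fin n) ℝ)
    {H : Matrix (Fin m) (Fin m) ℝ} (hH : H.PosSemidef) :
    minner (X * Xᵀ) H ≤ opNorm X ^ 2 * H.trace := by
  obtain ⟨k, b, rfl⟩ := posSemidef_iff_eq_sum_vecMulVec.mp hH
  simp only [star_trivial]
  have hsum : minner (X * Xᵀ) (∑ i, vecMulVec (b i) (b i)) =
      ∑ i, minner (X * Xᵀ) (vecMulVec (b i) (b i)) := by
    simp only [minner, Matrix.mul_sum, trace_sum]
  rw [hsum, trace_sum, Finset.mul_sum]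
  refine Finset.sum_le_sum fun i _ => ?_
  rw [minner_mul_transpose_vecMulVec, trace_vecMulVec]
  exact transpose_mulVec_dotProduct_self_le X (b i)

theorem isLUB_sqrt_minner {m n : ℕ} (hn : 1 ≤ n) (X : Matrix (Fin m) (Fin n) ℝ) :
    IsLUB {r | ∃ HL : Matrix (Fin m) (Fin m) ℝ, HL.PosSemidef ∧
      HL.trace ≤ 1 / n ∧ r = Real.sqrt (minner (X * Xᵀ) HL)} (opNorm X / Real.sqrt n) := by
  have hn0 : (0 : ℝ) < n := by exact_mod_cast hn
  constructor
  · rintro _ ⟨H, hH, htr, rfl⟩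
    refine Real.sqrt_le_iff.2 ⟨div_nonneg (opNorm_nonneg X) (Real.sqrt_nonneg _), ?_⟩
    rw [div_pow, Real.sq_sqrt hn0.le, div_eq_mul_one_div]
    exact (minner_mul_transpose_le X hH).trans (mul_le_mul_of_nonneg_left htr (sq_nonneg _))
  · intro S hS
    rw [div_le_iff₀ (Real.sqrt_pos.2 hn0)]
    have hS0 : 0 ≤ S :=
      (Real.sqrt_nonneg _).trans (hS ⟨0, PosSemidef.zero, by simp, rfl⟩)
    refine csSup_le ⟨_, 0, by simp, rfl⟩ ?_
    rintro _ ⟨v, hv, rfl⟩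
    set u := X.mulVec v
    rcases (dotProduct_self_nonneg_real u).eq_or_lt with h | h
    · rw [← h, Real.sqrt_zero]
      exact mul_nonneg hS0 (Real.sqrt_nonneg _)
    · rw [← div_le_iff₀ (Real.sqrt_pos.2 hn0), ← Real.sqrt_div' _ hn0.le]
      refine le_trans (Real.sqrt_le_sqrt ?_)
        (hS ⟨(1 / (n * (u ⬝ᵥ u))) • vecMulVec u u, ?_, ?_, rfl⟩)
      · have h1 : Xᵀ.mulVec u ⬝ᵥ v = u ⬝ᵥ u := transpose_mulVec_dotProduct X u v
        have h2 := dotProduct_sq_le (Xᵀ.mulVec u) v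
        rw [h1] at h2
        have h3 := h2.trans (mul_le_of_le_one_right (dotProduct_self_nonneg_real _) hv)
        rw [minner, Matrix.mul_smul, trace_smul, smul_eq_mul, ← minner,
          minner_mul_transpose_vecMulVec, one_div_mul_eq_div, div_le_div_iff₀ hn0 (by positivity)]
        nlinarith
      · have h1 := posSemidef_vecMulVec_self_star u
        rw [star_trivial] at h1
        exact h1.smul (by positivity)
      · rw [trace_smul, trace_vecMulVec, smul_eq_mul]
        exact le_of_eq (by field_simp)

theorem dotProduct_kronecker_one_mulVec {m n : Type*} [Fintype m] [Fintype n] [DecidableEq n]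
    (X : Matrix m n ℝ) (H : Matrix m m ℝ) :
    (fun p : m × n => X p.1 p.2) ⬝ᵥ
      (H ⊗ₖ (1 : Matrix n n ℝ)).mulVec (fun p : m × n => X p.1 p.2) =
      minner (X * Xᵀ) H := by
  have h : minner (X * Xᵀ) H = (Xᵀ * (H * X)).trace := by
    rw [minner, transpose_mul, transpose_transpose, Matrix.mul_assoc, trace_mul_comm,
      Matrix.mul_assoc]
  rw [h]
  simp only [dotProduct, mulVec, Fintype.sum_prod_type, kroneckerMap_apply, one_apply, trace,
    diag_apply, mul_apply, transpose_apply, mul_ite, mul_one, mul_zero, ite_mul, zero_mul,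
    Finset.sum_ite_eq, Finset.mem_univ, if_true]
  exact Finset.sum_comm

theorem stmt_11 {dL dR : ℕ} (hdL : 1 ≤ dL) (hdR : 1 ≤ dR)
    (X : Matrix (Fin dL) (Fin dR) ℝ) :
    sSup {r | ∃ HL : Matrix (Fin dL) (Fin dL) ℝ, HL.PosSemidef ∧
        HL.trace ≤ 1 / dR ∧ r = Real.sqrt (minner (X * Xᵀ) HL)} =
      opNorm X / Real.sqrt dR ∧
    sSup {r | ∃ H : Matrix (Fin dL × Fin dR) (Fin dL × Fin dR) ℝ,
        (∃ HL : Matrix (Fin dL) (Fin dL) ℝ, HL.PosSemidef ∧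
          H = HL ⊗ₖ (1 : Matrix (Fin dR) (Fin dR) ℝ)) ∧
        H.trace ≤ 1 ∧
        r = Real.sqrt ((fun p : Fin dL × Fin dR => X p.1 p.2) ⬝ᵥ
          H.mulVec (fun p : Fin dL × Fin dR => X p.1 p.2))} =
      opNorm X / Real.sqrt dR := by
  have hR : (0 : ℝ) < dR := by exact_mod_cast hdR
  have key := (isLUB_sqrt_minner hdR X).csSup_eq ⟨_, 0, PosSemidef.zero, by simp, rfl⟩
  refine ⟨key, Eq.trans (congrArg sSup (Set.ext fun r => ⟨?_, ?_⟩)) key⟩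
  · rintro ⟨_, ⟨HL, hHL, rfl⟩, htr, rfl⟩
    refine ⟨HL, hHL, ?_, by rw [dotProduct_kronecker_one_mulVec]⟩
    rw [trace_kronecker, trace_one, Fintype.card_fin] at htr
    rwa [le_div_iff₀ hR]
  · rintro ⟨HL, hHL, htr, rfl⟩
    refine ⟨_, ⟨HL, hHL, rfl⟩, ?_, by rw [dotProduct_kronecker_one_mulVec]⟩
    rw [trace_kronecker, trace_one, Fintype.card_fin]
    rwa [le_div_iff₀ hR] at htr
end

section
/- Let d_L, d_R ≥ 1 and let X_1,…,X_{T+1}, G_t, L_t, R_t be two-sided Shampoo iterates with parameters ε > 0 and η > 0, convex set 𝒳 ⊆ ℝ^{d_L×d_R}, and differentiable convex losses L_1,…,L_T : ℝ^{d_L×d_R} → ℝ, and suppose rank(G_t) ≤ r for every t. Then for every X* ∈ 𝒳: Σ_{t=1}^T L_t(X_t) − Σ_{t=1}^T L_t(X*) ≤ (D_F²/(2η) + r·η)·Tr(L_T^{1/4})·Tr(R_T^{1/4}), where D_F = max_{1≤t≤T} ‖X_t − X*‖_F and M^{1/4} := √(√M) for positive semidefinite M. -/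
open Matrix

attribute [local instance] Matrix.frobeniusNormedAddCommGroup Matrix.frobeniusNormedSpace

/-- The Frobenius norm of a real matrix. -/
noncomputable def frobNorm {m n : ℕ} (X : Matrix (Fin m) (Fin n) ℝ) : ℝ :=
  Real.sqrt ((Xᵀ * X).trace)

/-- Two-sided Shampoo iterates (Algorithm 3) with parameters `ε, η`, constraint set `𝒳`
and differentiable convex losses `Lf 1, …, Lf T`.  Here `G t` is the gradient of `Lf t` at
`x t`, `Lm t` and `Rm t` are the accumulated matrices, `SL t = √(Lm t)`,
`QL t = (Lm t)^{1/4} = √(SL t)`, and similarly for `SR t`, `QR t`. -/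
def TwoSidedShampoo {dL dR : ℕ} (ε η : ℝ) (𝒳 : Set (Matrix (Fin dL) (Fin dR) ℝ)) (T : ℕ)
    (Lf : ℕ → Matrix (Fin dL) (Fin dR) ℝ → ℝ)
    (x G : ℕ → Matrix (Fin dL) (Fin dR) ℝ)
    (Lm SL QL : ℕ → Matrix (Fin dL) (Fin dL) ℝ)
    (Rm SR QR : ℕ → Matrix (Fin dR) (Fin dR) ℝ) : Prop :=
  x 1 ∈ 𝒳 ∧ Lm 0 = ε • (1 : Matrix (Fin dL) (Fin dL) ℝ) ∧
    Rm 0 = ε • (1 : Matrix (Fin dR) (Fin dR) ℝ) ∧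
  ∀ t, 1 ≤ t → t ≤ T →
    Differentiable ℝ (Lf t) ∧ ConvexOn ℝ Set.univ (Lf t) ∧
    (∀ Δ : Matrix (Fin dL) (Fin dR) ℝ, fderiv ℝ (Lf t) (x t) Δ = ((G t)ᵀ * Δ).trace) ∧
    Lm t = Lm (t - 1) + G t * (G t)ᵀ ∧
    Rm t = Rm (t - 1) + (G t)ᵀ * G t ∧
    (SL t).PosSemidef ∧ SL t * SL t = Lm t ∧ (QL t).PosSemidef ∧ QL t * QL t = SL t ∧
    (SR t).PosSemidef ∧ SR t * SR t = Rm t ∧ (QR t).PosSemidef ∧ QR t * QR t = SR t ∧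
    x (t + 1) ∈ 𝒳 ∧
    (∀ Y ∈ 𝒳,
      ((x (t + 1) - (x t - η • ((QL t)⁻¹ * G t * (QR t)⁻¹)))ᵀ * QL t *
          (x (t + 1) - (x t - η • ((QL t)⁻¹ * G t * (QR t)⁻¹))) * QR t).trace ≤
      ((Y - (x t - η • ((QL t)⁻¹ * G t * (QR t)⁻¹)))ᵀ * QL t *
          (Y - (x t - η • ((QL t)⁻¹ * G t * (QR t)⁻¹))) * QR t).trace)

namespace Shampoo

section Trace

theorem transpose_eq_of_posSemidef {n : Type*} {M : Matrix n n ℝ} (hM : M.PosSemidef) : Mᵀ = M := by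
  simpa using hM.isHermitian.eq

variable {m n : Type*} [Fintype m] [Fintype n]

theorem exists_transpose_mul_self [DecidableEq n] {M : Matrix n n ℝ} (hM : M.PosSemidef) :
    ∃ C : Matrix n n ℝ, M = Cᵀ * C := by
  open scoped MatrixOrder in
  obtain ⟨C, hC⟩ := CStarAlgebra.nonneg_iff_eq_star_mul_self.mp hM.nonneg
  exact ⟨C, by simpa [star_eq_conjTranspose] using hC⟩

theorem trace_transpose_mul (X Y : Matrix m n ℝ) :
    (Xᵀ * Y).trace = ∑ p : m × n, X p.1 p.2 * Y p.1 p.2 := by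
  simp only [trace, diag_apply, mul_apply, transpose_apply, Fintype.sum_prod_type]
  exact Finset.sum_comm

theorem trace_transpose_mul_sq_le (X Y : Matrix m n ℝ) :
    (Xᵀ * Y).trace ^ 2 ≤ (Xᵀ * X).trace * (Yᵀ * Y).trace := by
  simp only [trace_transpose_mul, ← sq]
  exact Finset.sum_mul_sq_le_sq_mul_sq _ _ _

theorem trace_transpose_mul_self_nonneg (X : Matrix m n ℝ) : 0 ≤ (Xᵀ * X).trace := by
  rw [trace_transpose_mul]
  exact Finset.sum_nonneg fun _ _ => mul_self_nonneg _

theorem frobNorm_sq {m n : ℕ} (X : Matrix (Fin m) (Fin n) ℝ) :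
    frobNorm X ^ 2 = (Xᵀ * X).trace :=
  Real.sq_sqrt (trace_transpose_mul_self_nonneg X)

theorem frobenius_norm_sq (X : Matrix m n ℝ) : ‖X‖ ^ 2 = (Xᵀ * X).trace := by
  rw [frobenius_norm_def, ← Real.rpow_natCast, ← Real.rpow_mul (by positivity),
    trace_transpose_mul, Fintype.sum_prod_type]
  simp [sq]

/-- Cauchy–Schwarz for the semi-inner product weighted by a positive semidefinite matrix. -/
theorem trace_weighted_sq_le [DecidableEq m] {M : Matrix m m ℝ} (hM : M.PosSemidef)
    (X Y : Matrix m n ℝ) :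
    (Xᵀ * M * Y).trace ^ 2 ≤ (Xᵀ * M * X).trace * (Yᵀ * M * Y).trace := by
  obtain ⟨C, rfl⟩ := exists_transpose_mul_self hM
  simpa [Matrix.mul_assoc] using trace_transpose_mul_sq_le (C * X) (C * Y)

theorem trace_sandwich_eq (X : Matrix m n ℝ) (C : Matrix m m ℝ) (E : Matrix n n ℝ) :
    (Xᵀ * (Cᵀ * C) * X * (Eᵀ * E)).trace = ((C * X * Eᵀ)ᵀ * (C * X * Eᵀ)).trace := by
  rw [← Matrix.mul_assoc _ Eᵀ E, trace_mul_comm]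
  simp [Matrix.mul_assoc]

theorem trace_sandwich_nonneg [DecidableEq m] [DecidableEq n] {M : Matrix m m ℝ}
    {N : Matrix n n ℝ} (hM : M.PosSemidef) (hN : N.PosSemidef) (X : Matrix m n ℝ) :
    0 ≤ (Xᵀ * M * X * N).trace := by
  obtain ⟨C, rfl⟩ := exists_transpose_mul_self hM
  obtain ⟨E, rfl⟩ := exists_transpose_mul_self hN
  rw [trace_sandwich_eq]
  exact trace_transpose_mul_self_nonneg _

theorem trace_sandwich_le [DecidableEq m] [DecidableEq n] {M : Matrix m m ℝ}
    {N : Matrix n n ℝ} (hM : M.PosSemidef) (hN : N.PosSemidef) (X : Matrix m n ℝ) :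
    (Xᵀ * M * X * N).trace ≤ M.trace * N.trace * (Xᵀ * X).trace := by
  obtain ⟨C, rfl⟩ := exists_transpose_mul_self hM
  obtain ⟨E, rfl⟩ := exists_transpose_mul_self hN
  have hE : (Eᵀ * E).trace = ‖Eᵀ‖ ^ 2 := by
    rw [frobenius_norm_sq, transpose_transpose, trace_mul_comm]
  rw [trace_sandwich_eq, hE, ← frobenius_norm_sq, ← frobenius_norm_sq, ← frobenius_norm_sq]
  calc ‖C * X * Eᵀ‖ ^ 2 ≤ (‖C‖ * ‖X‖ * ‖Eᵀ‖) ^ 2 := by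
        gcongr
        exact (frobenius_norm_mul _ _).trans (by gcongr; exact frobenius_norm_mul _ _)
    _ = _ := by ring

theorem diag_weighted_sq_le {k : Type*} [DecidableEq m] {M : Matrix m m ℝ} (hM : M.PosSemidef)
    (X Y : Matrix m k ℝ) (i : k) :
    (Xᵀ * M * Y) i i ^ 2 ≤ (Xᵀ * M * X) i i * (Yᵀ * M * Y) i i := by
  have h := trace_weighted_sq_le hM (X.submatrix id fun _ : Unit => i)
    (Y.submatrix id fun _ : Unit => i)
  simpa [trace, mul_apply] using h

theorem diag_sandwich_le {k : Type*} [DecidableEq m] {M : Matrix m m ℝ} (hM : M.PosSemidef)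
    (X : Matrix m k ℝ) (i : k) :
    (Xᵀ * M * X) i i ≤ M.trace * (Xᵀ * X) i i := by
  have h := trace_sandwich_le hM (PosSemidef.one (n := Unit)) (X.submatrix id fun _ : Unit => i)
  simpa [trace, mul_apply] using h

theorem entry_sq_le [DecidableEq n] {K : Matrix n n ℝ} (hK : K.PosSemidef) (i j : n) :
    K i j ^ 2 ≤ K i i * K j j := by
  have h := diag_weighted_sq_le hK (replicateCol Unit (Pi.single i 1))
    (replicateCol Unit (Pi.single j 1)) ()
  simpa [mul_apply, Pi.single_apply] using h

/-- If the off-support entries of `K` vanish, the trace of a product of positive semidefinite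
matrices is controlled by the diagonals and the size of the support. -/
theorem trace_mul_le_card_mul [DecidableEq n] {K N : Matrix n n ℝ} (hK : K.PosSemidef)
    (hN : N.PosSemidef) (s : Finset n) (hs : ∀ i j, (i ∉ s ∨ j ∉ s) → K i j = 0) :
    (K * N).trace ≤ s.card * ∑ i, K i i * N i i := by
  have hd : ∀ i, 0 ≤ K i i * N i i := fun i => mul_nonneg hK.diag_nonneg hN.diag_nonneg
  have hsym : ∀ i j, N j i = N i j := fun i j => by simpa using hN.isHermitian.apply i j
  have hterm : ∀ i j, K i j * N j i ≤ (K i i * N i i + K j j * N j j) / 2 := by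
    intro i j
    refine abs_le_of_sq_le_sq' ?_ (by linarith [hd i, hd j]) |>.2
    rw [mul_pow, hsym]
    have h1 := mul_le_mul (entry_sq_le hK i j) (entry_sq_le hN i j) (sq_nonneg _)
      (mul_nonneg hK.diag_nonneg hK.diag_nonneg)
    nlinarith [sq_nonneg (K i i * N i i - K j j * N j j)]
  have hsum : (K * N).trace = ∑ i ∈ s, ∑ j ∈ s, K i j * N j i := by
    simp only [trace, diag_apply, mul_apply]
    rw [← Finset.sum_subset (Finset.subset_univ s)
      fun i _ hi => Finset.sum_eq_zero fun j _ => by rw [hs i j (.inl hi), zero_mul]]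
    exact Finset.sum_congr rfl fun i _ => (Finset.sum_subset (Finset.subset_univ s)
      fun j _ hj => by rw [hs i j (.inr hj), zero_mul]).symm
  calc (K * N).trace = ∑ i ∈ s, ∑ j ∈ s, K i j * N j i := hsum
    _ ≤ ∑ i ∈ s, ∑ j ∈ s, (K i i * N i i + K j j * N j j) / 2 :=
        Finset.sum_le_sum fun i _ => Finset.sum_le_sum fun j _ => hterm i j
    _ = s.card * ∑ i ∈ s, K i i * N i i := by
        simp only [add_div, Finset.sum_add_distrib, Finset.sum_const, nsmul_eq_mul,
          ← Finset.mul_sum, ← Finset.sum_div]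
        ring
    _ ≤ s.card * ∑ i, K i i * N i i := by
        gcongr
        · exact fun i _ _ => hd i
        · exact Finset.subset_univ s

end Trace

section Monotone

variable {n : Type*} [Fintype n] [DecidableEq n]

/-- Operator monotonicity of the square root. -/
theorem posSemidef_sub_of_sq {A B : Matrix n n ℝ} (hA : A.PosSemidef) (hB : B.PosSemidef)
    (h : (B * B - A * A).PosSemidef) : (B - A).PosSemidef := by
  have hH : (B - A).IsHermitian := hB.isHermitian.sub hA.isHermitian
  refine hH.posSemidef_iff_eigenvalues_nonneg.mpr fun i => ?_
  by_contra hneg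
  replace hneg : hH.eigenvalues i < 0 := not_le.mp hneg
  set l := hH.eigenvalues i
  set v : n → ℝ := ⇑(hH.eigenvectorBasis i)
  have hv : (B - A) *ᵥ v = l • v := hH.mulVec_eigenvectorBasis i
  have hvv : v ⬝ᵥ v = 1 := by
    have h1 : inner ℝ (hH.eigenvectorBasis i) (hH.eigenvectorBasis i) = (1 : ℝ) := by simp
    rwa [EuclideanSpace.inner_eq_star_dotProduct, star_trivial] at h1
  have hAv : A *ᵥ v = B *ᵥ v - l • v := by rw [← hv, sub_mulVec]; abel
  have hsq : ∀ {M : Matrix n n ℝ}, M.PosSemidef → v ⬝ᵥ ((M * M) *ᵥ v) = M *ᵥ v ⬝ᵥ M *ᵥ v := by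
    intro M hM
    rw [← mulVec_mulVec, dotProduct_mulVec, ← mulVec_transpose, transpose_eq_of_posSemidef hM]
  have h0 : 0 ≤ v ⬝ᵥ ((B * B - A * A) *ᵥ v) := by simpa using h.dotProduct_mulVec_nonneg v
  have hBv : 0 ≤ v ⬝ᵥ (B *ᵥ v) := by simpa using hB.dotProduct_mulVec_nonneg v
  rw [sub_mulVec, dotProduct_sub, hsq hA, hsq hB, hAv] at h0
  simp only [sub_dotProduct, dotProduct_sub, smul_dotProduct, dotProduct_smul, smul_eq_mul,
    hvv, dotProduct_comm (B *ᵥ v) v] at h0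
  nlinarith

end Monotone

section Potential

variable {m n : Type*} [Fintype m] [DecidableEq m] [Fintype n] [DecidableEq n]

/-- A tracial Hölder inequality comparing the traces of two positive semidefinite matrices. -/
theorem trace_pow_four_le {A A' : Matrix n n ℝ} (hA : A.PosSemidef) (hu : IsUnit A.det)
    (hA' : A'.PosSemidef) :
    A'.trace ^ 4 ≤ A.trace ^ 3 * (A⁻¹ * A⁻¹ * A⁻¹ * (A' * A' * (A' * A'))).trace := by
  have hT' := transpose_eq_of_posSemidef hA'
  have hTi := transpose_eq_of_posSemidef hA.inv
  have h1 := trace_weighted_sq_le hA 1 (A⁻¹ * A')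
  have h2 := trace_weighted_sq_le hA 1 (A⁻¹ * A⁻¹ * (A' * A'))
  have e1 : A * (A⁻¹ * A') = A' := mul_nonsing_inv_cancel_left _ _ hu
  have e2 : A * (A⁻¹ * A⁻¹ * (A' * A')) = A⁻¹ * (A' * A') := by
    rw [Matrix.mul_assoc A⁻¹, mul_nonsing_inv_cancel_left _ _ hu]
  simp only [transpose_one, Matrix.one_mul, Matrix.mul_one, Matrix.mul_assoc _ A, e1, e2,
    transpose_mul, hT', hTi] at h1 h2
  have e3 : (A' * A⁻¹ * A').trace = (A⁻¹ * (A' * A')).trace := by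
    rw [trace_mul_comm, ← Matrix.mul_assoc, trace_mul_comm]
  have e4 : (A' * A' * (A⁻¹ * A⁻¹) * (A⁻¹ * (A' * A'))).trace =
      (A⁻¹ * A⁻¹ * A⁻¹ * (A' * A' * (A' * A'))).trace := by
    rw [Matrix.mul_assoc (A' * A'), trace_mul_comm]
    simp only [Matrix.mul_assoc]
  rw [e3] at h1
  rw [e4] at h2
  have ha := hA.trace_nonneg
  calc A'.trace ^ 4 = (A'.trace ^ 2) ^ 2 := by ring
    _ ≤ (A.trace * (A⁻¹ * (A' * A')).trace) ^ 2 := by gcongr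
    _ = A.trace ^ 2 * (A⁻¹ * (A' * A')).trace ^ 2 := by ring
    _ ≤ A.trace ^ 2 * (A.trace * (A⁻¹ * A⁻¹ * A⁻¹ * (A' * A' * (A' * A'))).trace) := by gcongr
    _ = _ := by ring

theorem diag_inv_sq_le {k : Type*} [Finite k] {A : Matrix n n ℝ} (hA : A.PosSemidef) (hu : IsUnit A.det)
    (X : Matrix n k ℝ) (i : k) :
    (Xᵀ * A⁻¹ * X) i i ^ 2 ≤
      (A.trace * (Xᵀ * X) i i) * (Xᵀ * (A⁻¹ * A⁻¹ * A⁻¹) * X) i i := by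
  have hTi := transpose_eq_of_posSemidef hA.inv
  have h := diag_weighted_sq_le hA X (A⁻¹ * A⁻¹ * X) i
  have e1 : A * (A⁻¹ * A⁻¹ * X) = A⁻¹ * X := by
    rw [Matrix.mul_assoc A⁻¹, mul_nonsing_inv_cancel_left _ _ hu]
  have e2 : Xᵀ * (A⁻¹ * A⁻¹ * A⁻¹) * X = Xᵀ * (A⁻¹ * A⁻¹) * (A⁻¹ * X) := by
    simp only [Matrix.mul_assoc]
  have e3 : Xᵀ * A * (A⁻¹ * A⁻¹ * X) = Xᵀ * A⁻¹ * X := by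
    rw [Matrix.mul_assoc, e1, Matrix.mul_assoc]
  have e4 : (A⁻¹ * A⁻¹ * X)ᵀ * A * (A⁻¹ * A⁻¹ * X) = Xᵀ * (A⁻¹ * A⁻¹ * A⁻¹) * X := by
    rw [Matrix.mul_assoc, e1, e2, transpose_mul, transpose_mul, hTi]
  rw [e3, e4] at h
  have hPSD : (Xᵀ * (A⁻¹ * A⁻¹ * A⁻¹) * X).PosSemidef := by
    have := (hA.inv.pow 3).conjTranspose_mul_mul_same X
    simpa [pow_succ] using this
  exact h.trans (mul_le_mul_of_nonneg_right (diag_sandwich_le hA X i) hPSD.diag_nonneg)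

theorem trace_preconditioned_le {A : Matrix m m ℝ} {B : Matrix n n ℝ} (hA : A.PosSemidef)
    (hAu : IsUnit A.det) (hB : B.PosSemidef) (hBu : IsUnit B.det) (G : Matrix m n ℝ) {r : ℕ}
    (hr : G.rank ≤ r) :
    (Gᵀ * A⁻¹ * G * B⁻¹).trace ≤ r / 2 * (B.trace * (A⁻¹ * A⁻¹ * A⁻¹ * (G * Gᵀ)).trace +
      A.trace * (B⁻¹ * B⁻¹ * B⁻¹ * (Gᵀ * G)).trace) := by
  have hS : (Gᵀ * G).IsHermitian := by
    simpa using isHermitian_conjTranspose_mul_self G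
  set V : Matrix n n ℝ := ↑hS.eigenvectorUnitary
  set l := hS.eigenvalues
  have hVV : Vᵀ * V = 1 := by
    simpa [star_eq_conjTranspose] using Unitary.coe_star_mul_self hS.eigenvectorUnitary
  have hVV' : V * Vᵀ = 1 := by
    simpa [star_eq_conjTranspose] using Unitary.coe_mul_star_self hS.eigenvectorUnitary
  have hspec : Gᵀ * G = V * diagonal l * Vᵀ := by
    simpa [star_eq_conjTranspose, Unitary.conjStarAlgAut_apply, Function.comp_def] using
      hS.spectral_theorem
  set W := G * V with hW
  have hWW : Wᵀ * W = diagonal l := by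
    calc Wᵀ * W = Vᵀ * (Gᵀ * G) * V := by simp [hW, Matrix.mul_assoc]
      _ = (Vᵀ * V) * diagonal l * (Vᵀ * V) := by rw [hspec]; simp only [Matrix.mul_assoc]
      _ = diagonal l := by simp [hVV]
  have hG : G = W * Vᵀ := by rw [hW, Matrix.mul_assoc, hVV', Matrix.mul_one]
  set K := Wᵀ * A⁻¹ * W with hK
  set N := Vᵀ * B⁻¹ * V with hN
  set K₃ := Wᵀ * (A⁻¹ * A⁻¹ * A⁻¹) * W with hK₃
  set N₃ := Vᵀ * (B⁻¹ * B⁻¹ * B⁻¹) * V with hN₃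
  have hKp : K.PosSemidef := by simpa using hA.inv.conjTranspose_mul_mul_same W
  have hNp : N.PosSemidef := by simpa using hB.inv.conjTranspose_mul_mul_same V
  have hK₃p : K₃.PosSemidef := by
    simpa [pow_succ] using (hA.inv.pow 3).conjTranspose_mul_mul_same W
  have hN₃p : N₃.PosSemidef := by
    simpa [pow_succ] using (hB.inv.pow 3).conjTranspose_mul_mul_same V
  have hl0 : ∀ i, 0 ≤ l i := fun i => by
    have h := (posSemidef_conjTranspose_mul_self W).diag_nonneg (i := i)
    simpa [hWW] using h
  have e1 : (Gᵀ * A⁻¹ * G * B⁻¹).trace = (K * N).trace := by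
    have h : K * N = Vᵀ * (V * Wᵀ * A⁻¹ * (W * Vᵀ) * B⁻¹) * V := by
      rw [hK, hN]
      simp only [← Matrix.mul_assoc, hVV, Matrix.one_mul]
    have hGt : Gᵀ = V * Wᵀ := by
      rw [hW, transpose_mul, ← Matrix.mul_assoc, hVV', Matrix.one_mul]
    rw [h, trace_mul_comm _ V, ← Matrix.mul_assoc, hVV', Matrix.one_mul, ← hGt, ← hG]
  have e2 : (A⁻¹ * A⁻¹ * A⁻¹ * (G * Gᵀ)).trace = ∑ i, K₃ i i := by
    have h : G * Gᵀ = W * Wᵀ := by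
      rw [hW, transpose_mul, Matrix.mul_assoc, ← Matrix.mul_assoc V, hVV', Matrix.one_mul]
    rw [h, ← Matrix.mul_assoc, trace_mul_comm, ← Matrix.mul_assoc]
    rfl
  have e3 : (B⁻¹ * B⁻¹ * B⁻¹ * (Gᵀ * G)).trace = ∑ i, l i * N₃ i i := by
    rw [hspec, ← Matrix.mul_assoc, trace_mul_comm, ← Matrix.mul_assoc, ← Matrix.mul_assoc,
      ← hN₃, trace]
    simp [mul_comm]
  have hpt : ∀ i, K i i * N i i ≤ (B.trace * K₃ i i + A.trace * (l i * N₃ i i)) / 2 := by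
    intro i
    have h1 : K i i ^ 2 ≤ A.trace * l i * K₃ i i := by
      simpa [hWW] using diag_inv_sq_le hA hAu W i
    have h2 : N i i ^ 2 ≤ B.trace * N₃ i i := by
      simpa [hVV] using diag_inv_sq_le hB hBu V i
    have ha := hA.trace_nonneg
    have hb := hB.trace_nonneg
    have hk : 0 ≤ K₃ i i := hK₃p.diag_nonneg
    have hn : 0 ≤ N₃ i i := hN₃p.diag_nonneg
    have hli := hl0 i
    refine abs_le_of_sq_le_sq' ?_ (by positivity) |>.2
    have h3 := mul_le_mul h1 h2 (sq_nonneg _) (by positivity)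
    nlinarith [sq_nonneg (B.trace * K₃ i i - A.trace * (l i * N₃ i i))]
  classical
  set s : Finset n := Finset.univ.filter fun i => l i ≠ 0 with hs
  have hcard : (s.card : ℝ) ≤ r := by
    have h := hS.rank_eq_card_non_zero_eigs
    rw [rank_transpose_mul_self, Fintype.card_subtype] at h
    exact_mod_cast h ▸ hr
  have hcol : ∀ i ∉ s, ∀ k, W k i = 0 := by
    intro i hi k
    have hli : l i = 0 := by simpa [hs] using hi
    have h : (Wᵀ * W) i i = 0 := by rw [hWW]; simp [hli]
    simp only [mul_apply, transpose_apply] at h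
    exact mul_self_eq_zero.mp
      ((Finset.sum_eq_zero_iff_of_nonneg fun _ _ => mul_self_nonneg _).mp h k (Finset.mem_univ k))
  have hsupp : ∀ i j, (i ∉ s ∨ j ∉ s) → K i j = 0 := by
    rintro i j (h | h)
    · simp [hK, Matrix.mul_assoc, mul_apply (M := Wᵀ), hcol i h]
    · simp [hK, mul_apply (N := W), hcol j h]
  rw [e1, e2, e3]
  calc (K * N).trace ≤ s.card * ∑ i, K i i * N i i := trace_mul_le_card_mul hKp hNp s hsupp
    _ ≤ r * ∑ i, K i i * N i i := by
        gcongr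
        exact Finset.sum_nonneg fun i _ => mul_nonneg hKp.diag_nonneg hNp.diag_nonneg
    _ ≤ r * ∑ i, (B.trace * K₃ i i + A.trace * (l i * N₃ i i)) / 2 := by
        gcongr with i
        exact hpt i
    _ = _ := by
        rw [← Finset.sum_div, Finset.sum_add_distrib, ← Finset.mul_sum, ← Finset.mul_sum]
        ring

theorem mul_le_of_pow_four_le {a b a' b' p q : ℝ} (ha : 0 ≤ a) (hb : 0 ≤ b) (hp : p ≤ a)
    (hq : q ≤ b) (h1 : a' ^ 4 ≤ a ^ 3 * (a - p)) (h2 : b' ^ 4 ≤ b ^ 3 * (b - q)) :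
    a' * b' ≤ a * b - (b * p + a * q) / 4 := by
  have hu : 0 ≤ b * (a - p) := mul_nonneg hb (by linarith)
  have hw : 0 ≤ a * (b - q) := mul_nonneg ha (by linarith)
  have hm : 0 ≤ a * b := mul_nonneg ha hb
  set u := b * (a - p) with hu_def
  set w := a * (b - q) with hw_def
  have h4 : ((a' * b') ^ 2) ^ 2 ≤ (a * b * ((u + w) / 2)) ^ 2 := by
    have h3 : a' ^ 4 * b' ^ 4 ≤ a ^ 3 * (a - p) * (b ^ 3 * (b - q)) :=
      mul_le_mul h1 h2 (by positivity) (le_trans (by positivity) h1)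
    calc ((a' * b') ^ 2) ^ 2 = a' ^ 4 * b' ^ 4 := by ring
      _ ≤ (a * b) ^ 2 * (u * w) := by rw [hu_def, hw_def]; linarith
      _ ≤ (a * b) ^ 2 * ((u + w) / 2) ^ 2 := by
          gcongr
          nlinarith [sq_nonneg (u - w)]
      _ = _ := by ring
  have h5 : (a' * b') ^ 2 ≤ a * b * ((u + w) / 2) :=
    (abs_le_of_sq_le_sq' h4 (by positivity)).2
  have h6 : a' * b' ≤ (a * b + (u + w) / 2) / 2 := by
    refine (abs_le_of_sq_le_sq' ?_ (by positivity)).2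
    nlinarith [sq_nonneg (a * b - (u + w) / 2)]
  calc a' * b' ≤ (a * b + (u + w) / 2) / 2 := h6
    _ = _ := by rw [hu_def, hw_def]; ring

theorem trace_inv_cube_mul {A L' P : Matrix n n ℝ} (hu : IsUnit A.det)
    (h : A * A * (A * A) = L' + P) :
    (A⁻¹ * A⁻¹ * A⁻¹ * L').trace = A.trace - (A⁻¹ * A⁻¹ * A⁻¹ * P).trace := by
  have e : A⁻¹ * A⁻¹ * A⁻¹ * (A * A * (A * A)) = A := by
    simp only [Matrix.mul_assoc, nonsing_inv_mul_cancel_left _ _ hu]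
  rw [eq_sub_iff_add_eq, ← trace_add, ← Matrix.mul_add, ← h, e]

theorem trace_inv_cube_mul_nonneg {A L' : Matrix n n ℝ} (hA : A.PosSemidef)
    (hL' : L'.PosSemidef) : 0 ≤ (A⁻¹ * A⁻¹ * A⁻¹ * L').trace := by
  have h := trace_sandwich_nonneg (hA.inv.pow 3) hL' 1
  simpa [pow_succ] using h

/-- One step of the potential argument: the preconditioned gradient norm is paid for by the
growth of `Tr A · Tr B`. -/
theorem trace_preconditioned_le_potential {A L' : Matrix m m ℝ} {B R' : Matrix n n ℝ}
    {G : Matrix m n ℝ} {r : ℕ} {a' b' : ℝ} (hA : A.PosSemidef)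
    (hAu : IsUnit A.det) (hB : B.PosSemidef) (hBu : IsUnit B.det) (hr : G.rank ≤ r)
    (hL' : L'.PosSemidef) (hR' : R'.PosSemidef)
    (hAL : A * A * (A * A) = L' + G * Gᵀ) (hBR : B * B * (B * B) = R' + Gᵀ * G)
    (h1 : a' ^ 4 ≤ A.trace ^ 3 * (A⁻¹ * A⁻¹ * A⁻¹ * L').trace)
    (h2 : b' ^ 4 ≤ B.trace ^ 3 * (B⁻¹ * B⁻¹ * B⁻¹ * R').trace) :
    (Gᵀ * A⁻¹ * G * B⁻¹).trace ≤ 2 * r * (A.trace * B.trace - a' * b') := by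
  have hp := trace_inv_cube_mul_nonneg hA hL'
  have hq := trace_inv_cube_mul_nonneg hB hR'
  rw [trace_inv_cube_mul hAu hAL] at h1 hp
  rw [trace_inv_cube_mul hBu hBR] at h2 hq
  have h3 := mul_le_of_pow_four_le hA.trace_nonneg hB.trace_nonneg (by linarith) (by linarith)
    h1 h2
  refine (trace_preconditioned_le hA hAu hB hBu G hr).trans ?_
  have h4 := mul_le_mul_of_nonneg_left h3 (Nat.cast_nonneg (α := ℝ) r)
  linarith

end Potential

section Descent

theorem sub_le_fderiv_of_convexOn {E : Type*} [NormedAddCommGroup E] [NormedSpace ℝ E] {f : E → ℝ}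
    (hf : ConvexOn ℝ Set.univ f) {x : E} (hd : DifferentiableAt ℝ f x) (y : E) :
    f x - f y ≤ fderiv ℝ f x (x - y) := by
  have hc : ConvexOn ℝ Set.univ (f ∘ AffineMap.lineMap (k := ℝ) x y) := by
    simpa using hf.comp_affineMap (AffineMap.lineMap (k := ℝ) x y)
  have hg : HasDerivAt (f ∘ AffineMap.lineMap (k := ℝ) x y) (fderiv ℝ f x (y - x)) 0 := by
    refine HasFDerivAt.comp_hasDerivAt (0 : ℝ) ?_ AffineMap.hasDerivAt_lineMap
    simpa using hd.hasFDerivAt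
  have h := hc.le_slope_of_hasDerivAt (Set.mem_univ 0) (Set.mem_univ 1) one_pos hg
  simp only [slope_def_field, Function.comp_apply, AffineMap.lineMap_apply_zero,
    AffineMap.lineMap_apply_one, sub_zero, div_one] at h
  rw [← neg_sub y x, map_neg]
  linarith

variable {m n : Type*} [Fintype m] [Fintype n]

theorem trace_sandwich_add_smul {A : Matrix m m ℝ} {B : Matrix n n ℝ} (hA : A.PosSemidef)
    (hB : B.PosSemidef) (X Y : Matrix m n ℝ) (s : ℝ) :
    ((X + s • Y)ᵀ * A * (X + s • Y) * B).trace =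
      (Xᵀ * A * X * B).trace + 2 * s * (Yᵀ * A * X * B).trace +
        s ^ 2 * (Yᵀ * A * Y * B).trace := by
  have h : (Xᵀ * A * Y * B).trace = (Yᵀ * A * X * B).trace := by
    rw [← trace_transpose, trace_mul_comm (Yᵀ * A * X)]
    simp only [transpose_mul, transpose_transpose, transpose_eq_of_posSemidef hA,
      transpose_eq_of_posSemidef hB, Matrix.mul_assoc]
  simp only [transpose_add, transpose_smul, Matrix.add_mul, Matrix.mul_add, Matrix.smul_mul,
    Matrix.mul_smul, trace_add, trace_smul, smul_eq_mul, h]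
  ring

variable [DecidableEq m] [DecidableEq n]

/-- A weighted projection onto a convex set does not increase the distance to points of it. -/
theorem trace_sandwich_projection_le {A : Matrix m m ℝ} {B : Matrix n n ℝ} (hA : A.PosSemidef)
    (hB : B.PosSemidef) {𝒳 : Set (Matrix m n ℝ)} (h𝒳 : Convex ℝ 𝒳) {Z P Y : Matrix m n ℝ}
    (hP : P ∈ 𝒳) (hY : Y ∈ 𝒳)
    (hmin : ∀ Y ∈ 𝒳, ((P - Z)ᵀ * A * (P - Z) * B).trace ≤ ((Y - Z)ᵀ * A * (Y - Z) * B).trace) :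
    ((P - Y)ᵀ * A * (P - Y) * B).trace ≤ ((Z - Y)ᵀ * A * (Z - Y) * B).trace := by
  have hexp := trace_sandwich_add_smul hA hB (P - Z) (Y - P)
  have hneg : ∀ X : Matrix m n ℝ, ((-X)ᵀ * A * (-X) * B).trace = (Xᵀ * A * X * B).trace := by
    intro X; simp
  have hI : 0 ≤ ((Y - P)ᵀ * A * (P - Z) * B).trace := by
    by_contra! hlt
    set I := ((Y - P)ᵀ * A * (P - Z) * B).trace
    set N := ((Y - P)ᵀ * A * (Y - P) * B).trace
    have hN0 : 0 ≤ N := trace_sandwich_nonneg hA hB _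
    have hpos : 0 < N - I := by linarith
    set s := -I / (N - I)
    have hs0 : 0 < s := div_pos (by linarith) hpos
    have hs1 : s ≤ 1 := (div_le_one hpos).mpr (by linarith)
    have hmem : P + s • (Y - P) ∈ 𝒳 := h𝒳.add_smul_sub_mem hP hY ⟨hs0.le, hs1⟩
    have h := hmin _ hmem
    rw [show P + s • (Y - P) - Z = P - Z + s • (Y - P) by abel, hexp s] at h
    have hsN : s * (N - I) = -I := div_mul_cancel₀ _ hpos.ne'
    have h2 : 0 ≤ s * (2 * I + s * N) := by linarith
    have h3 : 0 ≤ 2 * I + s * N := nonneg_of_mul_nonneg_right h2 hs0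
    nlinarith
  have h1 := hexp 1
  rw [show P - Z + (1 : ℝ) • (Y - P) = -(Z - Y) by rw [one_smul]; abel, hneg] at h1
  rw [← neg_sub Y P, hneg, h1]
  have := trace_sandwich_nonneg hA hB (P - Z)
  linarith

/-- The regret inequality for one projected preconditioned gradient step. -/
theorem inner_gradient_le {A : Matrix m m ℝ} {B : Matrix n n ℝ} (hA : A.PosSemidef)
    (hAu : IsUnit A.det) (hB : B.PosSemidef) (hBu : IsUnit B.det) {η : ℝ} (hη : 0 < η)
    {𝒳 : Set (Matrix m n ℝ)} (h𝒳 : Convex ℝ 𝒳) {G X P Y : Matrix m n ℝ}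
    (hP : P ∈ 𝒳) (hY : Y ∈ 𝒳)
    (hmin : ∀ Y ∈ 𝒳, ((P - (X - η • (A⁻¹ * G * B⁻¹)))ᵀ * A *
        (P - (X - η • (A⁻¹ * G * B⁻¹))) * B).trace ≤
      ((Y - (X - η • (A⁻¹ * G * B⁻¹)))ᵀ * A * (Y - (X - η • (A⁻¹ * G * B⁻¹))) * B).trace) :
    (Gᵀ * (X - Y)).trace ≤
      (((X - Y)ᵀ * A * (X - Y) * B).trace - ((P - Y)ᵀ * A * (P - Y) * B).trace) / (2 * η) +
        η / 2 * (Gᵀ * A⁻¹ * G * B⁻¹).trace := by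
  have h := trace_sandwich_projection_le hA hB h𝒳 hP hY hmin
  have hdual : ∀ D : Matrix m n ℝ, ((A⁻¹ * G * B⁻¹)ᵀ * A * D * B).trace = (Gᵀ * D).trace := by
    intro D
    rw [trace_mul_comm]
    simp only [transpose_mul, transpose_eq_of_posSemidef hA.inv, transpose_eq_of_posSemidef hB.inv,
      ← Matrix.mul_assoc, mul_nonsing_inv _ hBu, Matrix.one_mul]
    rw [Matrix.mul_assoc Gᵀ, nonsing_inv_mul _ hAu, Matrix.mul_one]
  rw [show X - η • (A⁻¹ * G * B⁻¹) - Y = (X - Y) + (-η) • (A⁻¹ * G * B⁻¹) by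
    rw [neg_smul]; abel, trace_sandwich_add_smul hA hB, hdual, hdual] at h
  rw [← Matrix.mul_assoc, ← Matrix.mul_assoc] at h
  rw [div_add' _ _ _ (by positivity), le_div_iff₀ (by positivity)]
  linarith

theorem trace_sandwich_sub_le {A A' : Matrix m m ℝ} {B B' : Matrix n n ℝ} (hA' : A'.PosSemidef)
    (hB : B.PosSemidef) (hAA' : (A - A').PosSemidef) (hBB' : (B - B').PosSemidef)
    (X : Matrix m n ℝ) :
    (Xᵀ * A * X * B).trace - (Xᵀ * A' * X * B').trace ≤
      (A.trace * B.trace - A'.trace * B'.trace) * (Xᵀ * X).trace := by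
  have h1 := trace_sandwich_le hAA' hB X
  have h2 := trace_sandwich_le hA' hBB' X
  simp only [Matrix.mul_sub, Matrix.sub_mul, trace_sub] at h1 h2
  linarith

end Descent

section Accumulators

theorem posSemidef_self_mul_transpose {m n : Type*} [Finite n] [Fintype m] (G : Matrix n m ℝ) :
    (G * Gᵀ).PosSemidef := by
  simpa using posSemidef_self_mul_conjTranspose G

theorem posDef_accumulate {n : Type*} [DecidableEq n] {ε : ℝ} (hε : 0 < ε) {T : ℕ} {L P : ℕ → Matrix n n ℝ}
    (h0 : L 0 = ε • (1 : Matrix n n ℝ)) (hP : ∀ t, (P t).PosSemidef)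
    (hL : ∀ t, 1 ≤ t → t ≤ T → L t = L (t - 1) + P t) : ∀ t ≤ T, (L t).PosDef := by
  intro t
  induction t with
  | zero => intro _; rw [h0]; exact PosDef.one.smul hε
  | succ k ih =>
    intro hk
    rw [hL (k + 1) (by omega) hk, Nat.add_sub_cancel]
    exact (ih (by omega)).add_posSemidef (hP _)

variable {n : Type*} [Fintype n] [DecidableEq n]

theorem isUnit_det_of_pow_four {L S Q : Matrix n n ℝ} (hL : L.PosDef) (hS : S * S = L)
    (hQ : Q * Q = S) : IsUnit Q.det := by
  have h := (isUnit_iff_isUnit_det _).mp hL.isUnit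
  rw [← hS, ← hQ, det_mul, det_mul] at h
  exact isUnit_of_mul_isUnit_left (isUnit_of_mul_isUnit_left h)

theorem posSemidef_sub_of_pow_four {S S' Q Q' : Matrix n n ℝ} (hS : S.PosSemidef)
    (hS' : S'.PosSemidef) (hQ : Q.PosSemidef) (hQ' : Q'.PosSemidef) (hQS : Q * Q = S)
    (hQS' : Q' * Q' = S') (h : (S * S - S' * S').PosSemidef) : (Q - Q').PosSemidef := by
  refine posSemidef_sub_of_sq hQ' hQ ?_
  rw [hQS, hQS']
  exact posSemidef_sub_of_sq hS' hS h

end Accumulators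

end Shampoo

open Shampoo

theorem stmt_15 {dL dR : ℕ} (hdL : 1 ≤ dL) (hdR : 1 ≤ dR)
    (ε η : ℝ) (hε : 0 < ε) (hη : 0 < η)
    (𝒳 : Set (Matrix (Fin dL) (Fin dR) ℝ)) (h𝒳conv : Convex ℝ 𝒳) (h𝒳ne : 𝒳.Nonempty)
    (T : ℕ) (hT : 1 ≤ T) (Lf : ℕ → Matrix (Fin dL) (Fin dR) ℝ → ℝ)
    (x G : ℕ → Matrix (Fin dL) (Fin dR) ℝ)
    (Lm SL QL : ℕ → Matrix (Fin dL) (Fin dL) ℝ)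
    (Rm SR QR : ℕ → Matrix (Fin dR) (Fin dR) ℝ)
    (hiter : TwoSidedShampoo ε η 𝒳 T Lf x G Lm SL QL Rm SR QR)
    (r : ℕ) (hrank : ∀ t, 1 ≤ t → t ≤ T → (G t).rank ≤ r) :
    ∀ Xstar ∈ 𝒳, ∀ DF : ℝ,
      DF = sSup {s | ∃ t, 1 ≤ t ∧ t ≤ T ∧ s = frobNorm (x t - Xstar)} →
      ∑ t ∈ Finset.Icc 1 T, Lf t (x t) - ∑ t ∈ Finset.Icc 1 T, Lf t Xstar ≤
        (DF ^ 2 / (2 * η) + r * η) * ((QL T).trace * (QR T).trace) := by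
  intro Xs hXs DF hDF
  obtain ⟨-, hL0, hR0, hstep⟩ := hiter
  choose! hdiff hconv hgrad hLm hRm hSLp hSL hQLp hQL hSRp hSR hQRp hQR hxmem hmin using hstep
  have hLpd := posDef_accumulate hε hL0 (P := fun t => G t * (G t)ᵀ)
    (fun t => posSemidef_self_mul_transpose _) hLm
  have hRpd := posDef_accumulate hε hR0 (P := fun t => (G t)ᵀ * G t)
    (fun t => by simpa using posSemidef_self_mul_transpose (G t)ᵀ) hRm
  have hLu : ∀ t, 1 ≤ t → t ≤ T → IsUnit (QL t).det := fun t h1 h2 =>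
    isUnit_det_of_pow_four (hLpd t h2) (hSL t h1 h2) (hQL t h1 h2)
  have hRu : ∀ t, 1 ≤ t → t ≤ T → IsUnit (QR t).det := fun t h1 h2 =>
    isUnit_det_of_pow_four (hRpd t h2) (hSR t h1 h2) (hQR t h1 h2)
  have hL4 : ∀ t, 1 ≤ t → t ≤ T → QL t * QL t * (QL t * QL t) = Lm t := fun t h1 h2 => by
    rw [hQL t h1 h2, hSL t h1 h2]
  have hR4 : ∀ t, 1 ≤ t → t ≤ T → QR t * QR t * (QR t * QR t) = Rm t := fun t h1 h2 => by
    rw [hQR t h1 h2, hSR t h1 h2]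
  have hDFle : ∀ t, 1 ≤ t → t ≤ T → ((x t - Xs)ᵀ * (x t - Xs)).trace ≤ DF ^ 2 := by
    intro t h1 h2
    rw [← frobNorm_sq]
    have hfin : {s | ∃ t, 1 ≤ t ∧ t ≤ T ∧ s = frobNorm (x t - Xs)}.Finite :=
      ((Set.finite_Icc 1 T).image fun t => frobNorm (x t - Xs)).subset
        (by rintro s ⟨t, h1, h2, rfl⟩; exact ⟨t, ⟨h1, h2⟩, rfl⟩)
    have hle : frobNorm (x t - Xs) ≤ DF := hDF ▸ le_csSup hfin.bddAbove ⟨t, h1, h2, rfl⟩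
    exact pow_le_pow_left₀ (Real.sqrt_nonneg _) hle 2
  set N : ℕ → Matrix (Fin dL) (Fin dR) ℝ → ℝ := fun t X => (Xᵀ * QL t * X * QR t).trace with hN
  set q : ℕ → ℝ := fun t => ((G t)ᵀ * (QL t)⁻¹ * G t * (QR t)⁻¹).trace with hq
  have hregret : ∀ t ∈ Finset.Icc 1 T, Lf t (x t) - Lf t Xs ≤
      (N t (x t - Xs) - N t (x (t + 1) - Xs)) / (2 * η) + η / 2 * q t := by
    intro t ht
    obtain ⟨h1, h2⟩ := Finset.mem_Icc.mp ht
    refine ((sub_le_fderiv_of_convexOn (hconv t h1 h2) (hdiff t h1 h2 _) Xs).trans_eq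
      (hgrad t h1 h2 _)).trans ?_
    exact inner_gradient_le (hQLp t h1 h2) (hLu t h1 h2) (hQRp t h1 h2) (hRu t h1 h2) hη h𝒳conv
      (hxmem t h1 h2) hXs (hmin t h1 h2)
  have hqsum : ∀ k, 1 ≤ k → k ≤ T →
      ∑ t ∈ Finset.Icc 1 k, q t ≤ 2 * r * ((QL k).trace * (QR k).trace) := by
    intro k hk
    induction k, hk using Nat.le_induction with
    | base =>
      intro h
      have hA := hQLp 1 le_rfl h
      have hB := hQRp 1 le_rfl h
      have hpA := trace_inv_cube_mul_nonneg hA (hLpd 0 (by omega)).posSemidef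
      have hpB := trace_inv_cube_mul_nonneg hB (hRpd 0 (by omega)).posSemidef
      have := trace_preconditioned_le_potential (a' := 0) (b' := 0) hA (hLu 1 le_rfl h) hB
        (hRu 1 le_rfl h) (hrank 1 le_rfl h)
        (hLpd 0 (by omega)).posSemidef (hRpd 0 (by omega)).posSemidef
        ((hL4 1 le_rfl h).trans (hLm 1 le_rfl h)) ((hR4 1 le_rfl h).trans (hRm 1 le_rfl h))
        (by have := hA.trace_nonneg; rw [zero_pow four_ne_zero]; positivity)
        (by have := hB.trace_nonneg; rw [zero_pow four_ne_zero]; positivity)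
      simpa [hq] using this
    | succ k hk ih =>
      intro h
      have hk' : k ≤ T := by omega
      have h1 : 1 ≤ k + 1 := by omega
      have hA := hQLp (k + 1) h1 h
      have hB := hQRp (k + 1) h1 h
      have := trace_preconditioned_le_potential (a' := (QL k).trace) (b' := (QR k).trace) hA
        (hLu _ h1 h) hB (hRu _ h1 h) (hrank _ h1 h)
        (hLpd k hk').posSemidef (hRpd k hk').posSemidef
        ((hL4 _ h1 h).trans (hLm _ h1 h)) ((hR4 _ h1 h).trans (hRm _ h1 h))
        (by rw [← hL4 k hk hk']; exact trace_pow_four_le hA (hLu _ h1 h) (hQLp k hk hk'))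
        (by rw [← hR4 k hk hk']; exact trace_pow_four_le hB (hRu _ h1 h) (hQRp k hk hk'))
      rw [Finset.sum_Icc_succ_top h1]
      linarith [ih hk']
  have hNsum : ∀ k, 1 ≤ k → k ≤ T →
      ∑ t ∈ Finset.Icc 1 k, (N t (x t - Xs) - N t (x (t + 1) - Xs)) + N k (x (k + 1) - Xs) ≤
        DF ^ 2 * ((QL k).trace * (QR k).trace) := by
    intro k hk
    induction k, hk using Nat.le_induction with
    | base =>
      intro h
      have hA := hQLp 1 le_rfl h
      have hB := hQRp 1 le_rfl h
      have h1 := trace_sandwich_le hA hB (x 1 - Xs)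
      have h2 := mul_le_mul_of_nonneg_left (hDFle 1 le_rfl h)
        (mul_nonneg hA.trace_nonneg hB.trace_nonneg)
      simp only [Finset.Icc_self, Finset.sum_singleton, sub_add_cancel]
      linarith
    | succ k hk ih =>
      intro h
      have hk' : k ≤ T := by omega
      have h1 : 1 ≤ k + 1 := by omega
      have hLsub : (QL (k + 1) - QL k).PosSemidef := by
        refine posSemidef_sub_of_pow_four (hSLp _ h1 h) (hSLp k hk hk') (hQLp _ h1 h)
          (hQLp k hk hk') (hQL _ h1 h) (hQL k hk hk') ?_
        rw [hSL _ h1 h, hSL k hk hk', hLm _ h1 h, Nat.add_sub_cancel, add_sub_cancel_left]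
        exact posSemidef_self_mul_transpose _
      have hRsub : (QR (k + 1) - QR k).PosSemidef := by
        refine posSemidef_sub_of_pow_four (hSRp _ h1 h) (hSRp k hk hk') (hQRp _ h1 h)
          (hQRp k hk hk') (hQR _ h1 h) (hQR k hk hk') ?_
        rw [hSR _ h1 h, hSR k hk hk', hRm _ h1 h, Nat.add_sub_cancel, add_sub_cancel_left]
        simpa using posSemidef_self_mul_transpose (G (k + 1))ᵀ
      have h2 := trace_sandwich_sub_le (hQLp k hk hk') (hQRp _ h1 h) hLsub hRsub (x (k + 1) - Xs)
      have hmono : 0 ≤ (QL (k + 1)).trace * (QR (k + 1)).trace - (QL k).trace * (QR k).trace := by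
        have e1 := hLsub.trace_nonneg
        have e2 := hRsub.trace_nonneg
        rw [trace_sub] at e1 e2
        have := mul_le_mul (sub_nonneg.mp e1) (sub_nonneg.mp e2) (hQRp k hk hk').trace_nonneg
          (hQLp _ h1 h).trace_nonneg
        linarith
      have h3 := mul_le_mul_of_nonneg_left (hDFle _ h1 h) hmono
      rw [Finset.sum_Icc_succ_top h1]
      have := ih hk'
      simp only [hN] at this ⊢
      linarith
  have hlast : 0 ≤ N T (x (T + 1) - Xs) :=
    trace_sandwich_nonneg (hQLp T hT le_rfl) (hQRp T hT le_rfl) _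
  rw [← Finset.sum_sub_distrib]
  refine (Finset.sum_le_sum hregret).trans ?_
  rw [Finset.sum_add_distrib, ← Finset.sum_div, ← Finset.mul_sum]
  calc _ ≤ DF ^ 2 * ((QL T).trace * (QR T).trace) / (2 * η) +
        η / 2 * (2 * r * ((QL T).trace * (QR T).trace)) := by
        gcongr
        · linarith [hNsum T hT le_rfl]
        · exact hqsum T hT le_rfl
    _ = _ := by ring
end

section
/- Let d_L, d_R ≥ 1 and G_1,…,G_T ∈ ℝ^{d_L×d_R}, and set L = Σ_{t=1}^T G_t G_tᵀ and R = Σ_{t=1}^T G_tᵀ G_t. Then Tr(L^{1/4})·Tr(R^{1/4}) ≥ Tr(√L), where √M denotes the unique positive semidefinite square root of a positive semidefinite matrix M and M^{1/4} := √(√M). -/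
open Matrix

/-- The trace of a power of a Hermitian matrix is the power sum of its eigenvalues. -/
theorem Matrix.IsHermitian.trace_pow_eq_sum_eigenvalues_pow {n : Type*} [Fintype n] [DecidableEq n]
    {A : Matrix n n ℝ} (hA : A.IsHermitian) (k : ℕ) :
    (A ^ k).trace = ∑ i, hA.eigenvalues i ^ k := by
  conv_lhs => rw [hA.spectral_theorem, ← map_pow, Unitary.conjStarAlgAut_apply, trace_mul_cycle]
  simp [diagonal_pow, trace_diagonal]

/-- If two nonnegative families have the same sum of fourth powers, then the sum of squares of the
first is at most the product of the sums. -/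
theorem sum_sq_le_sum_mul_sum_of_sum_pow_four_eq {ι κ : Type*} [Fintype ι] [Fintype κ]
    {q : ι → ℝ} {p : κ → ℝ} (hq : ∀ i, 0 ≤ q i) (hp : ∀ j, 0 ≤ p j)
    (h : ∑ i, q i ^ 4 = ∑ j, p j ^ 4) :
    ∑ i, q i ^ 2 ≤ (∑ i, q i) * ∑ j, p j := by
  have hp0 : 0 ≤ ∑ j, p j := Finset.sum_nonneg fun j _ => hp j
  have hle : ∀ i, q i ≤ ∑ j, p j := fun i => by
    refine le_of_pow_le_pow_left₀ four_ne_zero hp0 ?_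
    calc q i ^ 4 ≤ ∑ i, q i ^ 4 :=
          Finset.single_le_sum (f := fun i => q i ^ 4) (fun i _ => pow_nonneg (hq i) 4)
            (Finset.mem_univ i)
      _ = ∑ j, p j * p j ^ 3 := by rw [h]; exact Finset.sum_congr rfl fun j _ => by ring
      _ ≤ ∑ j, p j * (∑ j, p j) ^ 3 := by
          gcongr with j
          · exact hp j
          · exact hp j
          · exact Finset.single_le_sum (fun j _ => hp j) (Finset.mem_univ j)
      _ = (∑ j, p j) ^ 4 := by rw [← Finset.sum_mul]; ring
  rw [Finset.sum_mul]
  refine Finset.sum_le_sum fun i _ => ?_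
  rw [sq]
  exact mul_le_mul_of_nonneg_left (hle i) (hq i)

theorem stmt_16 {dL dR : ℕ} (hdL : 1 ≤ dL) (hdR : 1 ≤ dR) (T : ℕ)
    (G : Fin T → Matrix (Fin dL) (Fin dR) ℝ)
    (L : Matrix (Fin dL) (Fin dL) ℝ) (hL : L = ∑ t, G t * (G t)ᵀ)
    (R : Matrix (Fin dR) (Fin dR) ℝ) (hR : R = ∑ t, (G t)ᵀ * G t)
    (SL QL : Matrix (Fin dL) (Fin dL) ℝ)
    (hSL : SL.PosSemidef) (hSL2 : SL * SL = L)
    (hQL : QL.PosSemidef) (hQL2 : QL * QL = SL)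
    (SR QR : Matrix (Fin dR) (Fin dR) ℝ)
    (hSR : SR.PosSemidef) (hSR2 : SR * SR = R)
    (hQR : QR.PosSemidef) (hQR2 : QR * QR = SR) :
    SL.trace ≤ QL.trace * QR.trace := by
  have hLR : L.trace = R.trace := by
    rw [hL, hR, trace_sum, trace_sum]
    exact Finset.sum_congr rfl fun t _ => trace_mul_comm _ _
  have hL4 : QL ^ 4 = L := by rw [← hSL2, ← hQL2]; noncomm_ring
  have hR4 : QR ^ 4 = R := by rw [← hSR2, ← hQR2]; noncomm_ring
  have h := sum_sq_le_sum_mul_sum_of_sum_pow_four_eq hQL.eigenvalues_nonneg hQR.eigenvalues_nonneg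
    (by rw [← hQL.isHermitian.trace_pow_eq_sum_eigenvalues_pow,
      ← hQR.isHermitian.trace_pow_eq_sum_eigenvalues_pow, hL4, hR4, hLR])
  have hL1 := hQL.isHermitian.trace_pow_eq_sum_eigenvalues_pow 1
  have hR1 := hQR.isHermitian.trace_pow_eq_sum_eigenvalues_pow 1
  simp only [pow_one] at hL1 hR1
  rwa [← hQL.isHermitian.trace_pow_eq_sum_eigenvalues_pow, ← hL1, ← hR1, sq, hQL2] at h
end

section
/- Let M be a symmetric positive definite d×d real matrix and let η > 0. Then (1/η)·√M is the unique minimizer of the function H ↦ ⟨M, H⁻¹⟩ + η²·Tr(H) over the set of symmetric positive definite d×d real matrices; i.e., for every symmetric positive definite H one has ⟨M, ((1/η)·√M)⁻¹⟩ + η²·Tr((1/η)·√M) ≤ ⟨M, H⁻¹⟩ + η²·Tr(H), with equality only when H = (1/η)·√M. -/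
open Matrix

/-- The weighted trace form `D ↦ Tr(D A Dᴴ)` of a positive definite matrix `A` is definite. -/
theorem Matrix.PosDef.eq_zero_of_trace_mul_mul_conjTranspose_eq_zero
    {m n : Type*} [Fintype m] [Fintype n] {A : Matrix n n ℝ} (hA : A.PosDef)
    {D : Matrix m n ℝ} (h : (D * A * Dᴴ).trace = 0) : D = 0 := by
  have hz : D * A * Dᴴ = 0 := (hA.posSemidef.mul_mul_conjTranspose_same D).trace_eq_zero_iff.1 h
  rw [← conjTranspose_eq_zero]
  refine mulVec_injective (funext fun x => ?_)
  rw [zero_mulVec]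
  by_contra hx
  have hpos := hA.dotProduct_mulVec_pos hx
  rw [star_mulVec, conjTranspose_conjTranspose, ← dotProduct_mulVec, mulVec_mulVec, mulVec_mulVec,
    hz] at hpos
  simp at hpos

/-- Completing the square in `H ↦ Tr(S² H⁻¹) + η² Tr H`. -/
theorem Matrix.trace_sub_smul_mul_inv_mul_sub_smul {n R : Type*} [Fintype n] [DecidableEq n]
    [CommRing R] (S H : Matrix n n R) (hH : IsUnit H.det) (η : R) :
    ((S - η • H) * H⁻¹ * (S - η • H)).trace =
      (S * S * H⁻¹).trace + η ^ 2 * H.trace - 2 * η * S.trace := by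
  have hexp : (S - η • H) * H⁻¹ * (S - η • H) =
      S * H⁻¹ * S - η • S - η • S + η ^ 2 • H := by
    simp only [sub_mul, mul_sub, smul_mul_assoc, mul_smul_comm, mul_nonsing_inv _ hH,
      nonsing_inv_mul_cancel_right _ _ hH, one_mul, smul_sub, smul_smul, pow_two]
    abel
  rw [hexp, Matrix.trace_add, Matrix.trace_sub, Matrix.trace_sub, trace_mul_cycle S H⁻¹ S]
  simp only [trace_smul, smul_eq_mul]
  ring

theorem stmt_17 {d : ℕ} (M : Matrix (Fin d) (Fin d) ℝ) (hM : M.PosDef)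
    (η : ℝ) (hη : 0 < η)
    (S : Matrix (Fin d) (Fin d) ℝ) (hS : S.PosSemidef) (hS2 : S * S = M) :
    (η⁻¹ • S).PosDef ∧
      ∀ H : Matrix (Fin d) (Fin d) ℝ, H.PosDef →
        (minner M (η⁻¹ • S)⁻¹ + η ^ 2 * (η⁻¹ • S).trace ≤ minner M H⁻¹ + η ^ 2 * H.trace ∧
          (minner M (η⁻¹ • S)⁻¹ + η ^ 2 * (η⁻¹ • S).trace = minner M H⁻¹ + η ^ 2 * H.trace →
            H = η⁻¹ • S)) := by
  have hMT : Mᵀ = M := hM.isHermitian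
  have hSunit : IsUnit S := by
    have hMunit := hM.isUnit
    rw [← hS2, isUnit_iff_isUnit_det, det_mul] at hMunit
    exact (isUnit_iff_isUnit_det S).2 (isUnit_of_mul_isUnit_left hMunit)
  have hpos : (η⁻¹ • S).PosDef := (hS.posDef_iff_isUnit.2 hSunit).smul (inv_pos.2 hη)
  -- completing the square measures the objective at every `H` against `2 η Tr S`
  have hsquare : ∀ H : Matrix (Fin d) (Fin d) ℝ, H.PosDef →
      minner M H⁻¹ + η ^ 2 * H.trace =
        ((S - η • H) * H⁻¹ * (S - η • H)).trace + 2 * η * S.trace := by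
    intro H hH
    rw [trace_sub_smul_mul_inv_mul_sub_smul S H ((isUnit_iff_isUnit_det H).1 hH.isUnit) η, hS2,
      minner, hMT]
    ring
  have hmin : minner M (η⁻¹ • S)⁻¹ + η ^ 2 * (η⁻¹ • S).trace = 2 * η * S.trace := by
    rw [hsquare _ hpos, smul_inv_smul₀ hη.ne']
    simp
  refine ⟨hpos, fun H hH => ?_⟩
  have hherm : (S - η • H)ᴴ = S - η • H := by
    rw [conjTranspose_sub, conjTranspose_smul, hS.isHermitian.eq, hH.isHermitian.eq, star_trivial]
  rw [hmin, hsquare H hH]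
  constructor
  · have hnonneg := (hH.inv.posSemidef.mul_mul_conjTranspose_same (S - η • H)).trace_nonneg
    rw [hherm] at hnonneg
    linarith
  · intro heq
    have hzero : S - η • H = 0 := by
      refine hH.inv.eq_zero_of_trace_mul_mul_conjTranspose_eq_zero ?_
      rw [hherm]
      linarith
    rw [sub_eq_zero.1 hzero, inv_smul_smul₀ hη.ne']
end

section
/- Let A be a symmetric positive semidefinite d×d real matrix. Then inf{⟨A, H⁻¹⟩ : H a symmetric positive definite d×d real matrix with Tr(H) ≤ 1} = (Tr(√A))², where √A denotes the unique positive semidefinite square root of A; in particular, when A is positive definite the infimum is attained at H = √A / Tr(√A). -/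
open Matrix

theorem minner_self_mul_self {n : Type*} [Fintype n] {S : Matrix n n ℝ}
    (hS : S.IsHermitian) (B : Matrix n n ℝ) : minner (S * S) B = (S * S * B).trace := by
  have hST : Sᵀ = S := by simpa using hS.eq
  rw [minner, Matrix.transpose_mul, hST]

theorem Matrix.PosSemidef.posDef_add_smul_one {n : Type*} [DecidableEq n] {S : Matrix n n ℝ}
    (hS : S.PosSemidef) {ε : ℝ} (hε : 0 < ε) : (S + ε • (1 : Matrix n n ℝ)).PosDef :=
  Matrix.PosDef.posSemidef_add hS (Matrix.PosDef.one.smul hε)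

section TraceInverse

variable {n : Type*} [Fintype n] [DecidableEq n]

theorem Matrix.PosDef.inv_smul_of_pos {P : Matrix n n ℝ} (hP : P.PosDef) {c : ℝ} (hc : 0 < c) :
    (c⁻¹ • P)⁻¹ = c • P⁻¹ := by
  have hu : IsUnit P.det := hP.det_pos.ne'.isUnit
  apply Matrix.inv_eq_right_inv
  rw [Matrix.smul_mul, Matrix.mul_smul, Matrix.mul_nonsing_inv _ hu, smul_smul,
    inv_mul_cancel₀ hc.ne', one_smul]

/-- Expanding `0 ≤ Tr ((S - t H) H⁻¹ (S - t H))` at `t = Tr S`. -/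
theorem sq_trace_le_minner_inv {S H : Matrix n n ℝ} (hS : S.IsHermitian) (hH : H.PosDef)
    (hH1 : H.trace ≤ 1) : S.trace ^ 2 ≤ minner (S * S) H⁻¹ := by
  have hu : IsUnit H.det := hH.det_pos.ne'.isUnit
  have hpsd := (hH.inv.posSemidef.conjTranspose_mul_mul_same (S - S.trace • H)).trace_nonneg
  have hherm : (S - S.trace • H)ᴴ = S - S.trace • H := by
    rw [Matrix.conjTranspose_sub, Matrix.conjTranspose_smul, hS.eq, hH.isHermitian.eq,
      star_trivial]
  have hexpand : (S - S.trace • H) * H⁻¹ * (S - S.trace • H)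
      = S * H⁻¹ * S - (2 * S.trace) • S + S.trace ^ 2 • H := by
    have h1 : (S - S.trace • H) * H⁻¹ = S * H⁻¹ - S.trace • (1 : Matrix n n ℝ) := by
      rw [Matrix.sub_mul, Matrix.smul_mul, Matrix.mul_nonsing_inv _ hu]
    rw [h1, Matrix.sub_mul, Matrix.mul_sub, Matrix.mul_smul, Matrix.mul_assoc S H⁻¹ H,
      Matrix.nonsing_inv_mul _ hu, Matrix.mul_one, Matrix.smul_mul, Matrix.one_mul]
    module
  rw [hherm, hexpand, Matrix.trace_add, Matrix.trace_sub, Matrix.trace_smul, Matrix.trace_smul,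
    smul_eq_mul, smul_eq_mul, Matrix.trace_mul_comm (S * H⁻¹) S, ← Matrix.mul_assoc] at hpsd
  rw [minner_self_mul_self hS]
  nlinarith [mul_le_mul_of_nonneg_left hH1 (sq_nonneg S.trace)]

theorem Matrix.PosSemidef.trace_mul_self_mul_inv_add_smul_one_le {S : Matrix n n ℝ}
    (hS : S.PosSemidef) {ε : ℝ} (hε : 0 < ε) :
    (S * S * (S + ε • (1 : Matrix n n ℝ))⁻¹).trace ≤ S.trace := by
  have hP := hS.posDef_add_smul_one hε
  set P := S + ε • (1 : Matrix n n ℝ) with hPdef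
  have hu : IsUnit P.det := hP.det_pos.ne'.isUnit
  have hSP : S * P = S * S + ε • S := by
    rw [hPdef, Matrix.mul_add, Matrix.mul_smul, Matrix.mul_one]
  have hSPpsd : (S * P).PosSemidef := by
    rw [hSP]
    have hSS := Matrix.posSemidef_conjTranspose_mul_self S
    rw [hS.isHermitian.eq] at hSS
    exact hSS.add (hS.smul hε.le)
  have hnonneg := (hSPpsd.conjTranspose_mul_mul_same P⁻¹).trace_nonneg
  rw [hP.inv.isHermitian.eq, Matrix.mul_assoc, Matrix.mul_assoc, Matrix.mul_nonsing_inv _ hu,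
    Matrix.mul_one, Matrix.trace_mul_comm] at hnonneg
  have hsplit : S * S * P⁻¹ = S - ε • (S * P⁻¹) := by
    rw [eq_sub_iff_add_eq, ← Matrix.smul_mul, ← Matrix.add_mul, ← hSP, Matrix.mul_assoc,
      Matrix.mul_nonsing_inv _ hu, Matrix.mul_one]
  rw [hsplit, Matrix.trace_sub, Matrix.trace_smul, smul_eq_mul]
  linarith [mul_nonneg hε.le hnonneg]

theorem Matrix.PosSemidef.exists_posDef_minner_inv_le {S : Matrix n n ℝ} (hS : S.PosSemidef)
    {δ : ℝ} (hδ : 0 < δ) :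
    ∃ H : Matrix n n ℝ, H.PosDef ∧ H.trace ≤ 1 ∧ minner (S * S) H⁻¹ ≤ S.trace ^ 2 + δ := by
  have hs : 0 ≤ S.trace := hS.trace_nonneg
  set s := S.trace with hsdef
  set m : ℝ := (Fintype.card n : ℝ) with hm
  have hm0 : 0 ≤ m := Nat.cast_nonneg _
  obtain ⟨ε, hε, hεδ⟩ : ∃ ε : ℝ, 0 < ε ∧ ε * (m + 1) * (s + 1) = δ :=
    ⟨δ / ((m + 1) * (s + 1)), by positivity, by field_simp⟩
  have hP := hS.posDef_add_smul_one hε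
  have hc : 0 < s + ε * (m + 1) := by positivity
  refine ⟨(s + ε * (m + 1))⁻¹ • (S + ε • (1 : Matrix n n ℝ)), hP.smul (inv_pos.2 hc), ?_, ?_⟩
  · rw [Matrix.trace_smul, Matrix.trace_add, Matrix.trace_smul, Matrix.trace_one, smul_eq_mul,
      smul_eq_mul, inv_mul_le_iff₀ hc, ← hm, ← hsdef]
    linarith
  · rw [minner_self_mul_self hS.isHermitian, hP.inv_smul_of_pos hc, Matrix.mul_smul,
      Matrix.trace_smul, smul_eq_mul]
    have hle := mul_le_mul_of_nonneg_left (hS.trace_mul_self_mul_inv_add_smul_one_le hε) hc.le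
    have hpos : 0 < ε * (m + 1) := by positivity
    rw [← hsdef] at hle
    nlinarith

theorem Matrix.PosDef.trace_inv_smul_optimal {S : Matrix n n ℝ} (hS : S.PosDef) :
    (S.trace⁻¹ • S).PosDef ∧ (S.trace⁻¹ • S).trace ≤ 1 ∧
      minner (S * S) (S.trace⁻¹ • S)⁻¹ = S.trace ^ 2 := by
  have hu : IsUnit S.det := hS.det_pos.ne'.isUnit
  rcases isEmpty_or_nonempty n with hn | hn
  · refine ⟨?_, by simp [Matrix.trace], by simp [minner, Matrix.trace]⟩
    rwa [Subsingleton.elim (S.trace⁻¹ • S) S]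
  · have hs : 0 < S.trace := hS.trace_pos
    refine ⟨hS.smul (inv_pos.2 hs), ?_, ?_⟩
    · rw [Matrix.trace_smul, smul_eq_mul, inv_mul_cancel₀ hs.ne']
    · rw [minner_self_mul_self hS.isHermitian, hS.inv_smul_of_pos hs, Matrix.mul_smul,
        Matrix.mul_assoc, Matrix.mul_nonsing_inv _ hu, Matrix.mul_one, Matrix.trace_smul,
        smul_eq_mul, sq]

end TraceInverse

theorem stmt_18 {d : ℕ} (A : Matrix (Fin d) (Fin d) ℝ) (hA : A.PosSemidef)
    (S : Matrix (Fin d) (Fin d) ℝ) (hS : S.PosSemidef) (hS2 : S * S = A) :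
    sInf {r | ∃ H : Matrix (Fin d) (Fin d) ℝ, H.PosDef ∧ H.trace ≤ 1 ∧
        r = minner A H⁻¹} = S.trace ^ 2 ∧
      (A.PosDef →
        ((S.trace)⁻¹ • S).PosDef ∧ ((S.trace)⁻¹ • S).trace ≤ 1 ∧
          minner A ((S.trace)⁻¹ • S)⁻¹ = S.trace ^ 2) := by
  subst hS2
  refine ⟨?_, fun hSS => ?_⟩
  · refine csInf_eq_of_forall_ge_of_forall_gt_exists_lt ?_ ?_ ?_
    · obtain ⟨H, hH, hH1, -⟩ := hS.exists_posDef_minner_inv_le one_pos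
      exact ⟨_, H, hH, hH1, rfl⟩
    · rintro _ ⟨H, hH, hH1, rfl⟩
      exact sq_trace_le_minner_inv hS.isHermitian hH hH1
    · intro w hw
      obtain ⟨H, hH, hH1, hle⟩ := hS.exists_posDef_minner_inv_le (half_pos (sub_pos.2 hw))
      exact ⟨_, ⟨H, hH, hH1, rfl⟩, by linarith⟩
  · refine Matrix.PosDef.trace_inv_smul_optimal (hS.posDef_iff_det_ne_zero.2 fun h => ?_)
    exact hSS.det_pos.ne' (by rw [Matrix.det_mul, h, zero_mul])
end

section
/- Let d_L, d_R ≥ 1, ε > 0, η > 0, and G_1,…,G_t ∈ ℝ^{d_L×d_R}. Then the function H_L ↦ ε·d_R·Tr(H_L⁻¹) + Σ_{s=1}^t Tr(G_sᵀ·H_L⁻¹·G_s) + η²·d_R·Tr(H_L) on symmetric positive definite d_L×d_L real matrices attains its minimum uniquely at H_L = (1/η)·√(ε·I_{d_L} + (1/d_R)·Σ_{s=1}^t G_s G_sᵀ). -/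
open Matrix

/-- Completing the square for `X ↦ tr (X⁻¹ A²) + tr X` around `A`. -/
theorem trace_inv_mul_sq_add_trace {n : Type*} [Fintype n] [DecidableEq n]
    {A H : Matrix n n ℝ} (hA : A.IsHermitian) (hH : H.PosDef) :
    (H⁻¹ * (A * A)).trace + H.trace
      = 2 * A.trace + ((H - A)ᴴ * H⁻¹ * (H - A)).trace := by
  have hdet : IsUnit H.det := (Matrix.isUnit_iff_isUnit_det H).1 hH.isUnit
  have hexp : (H - A)ᴴ * H⁻¹ * (H - A) = H - A - A + A * H⁻¹ * A := by
    rw [conjTranspose_sub, hH.isHermitian.eq, hA.eq, Matrix.sub_mul, Matrix.mul_nonsing_inv H hdet,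
      Matrix.sub_mul, Matrix.mul_sub, Matrix.mul_sub, Matrix.mul_assoc A H⁻¹ H, Matrix.nonsing_inv_mul H hdet,
      Matrix.mul_one, Matrix.one_mul, Matrix.one_mul]
    abel
  have hcyc : (A * H⁻¹ * A).trace = (H⁻¹ * (A * A)).trace := by
    rw [Matrix.mul_assoc, Matrix.trace_mul_comm, Matrix.mul_assoc]
  rw [hexp, trace_add, trace_sub, trace_sub, hcyc]
  ring

theorem eq_zero_of_trace_conjTranspose_mul_mul_same {n : Type*} [Fintype n] [DecidableEq n]
    {P D : Matrix n n ℝ} (hP : P.PosDef) (h : (Dᴴ * P * D).trace = 0) : D = 0 := by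
  have hzero := (hP.posSemidef.conjTranspose_mul_mul_same D).trace_eq_zero_iff.1 h
  refine Matrix.ext_of_mulVec_single fun i => ?_
  rw [Matrix.zero_mulVec]
  by_contra hne
  refine (hP.dotProduct_mulVec_pos hne).ne' ?_
  rw [star_mulVec, ← dotProduct_mulVec, mulVec_mulVec, mulVec_mulVec, hzero,
    zero_mulVec, dotProduct_zero]

theorem stmt_19 {dL dR : ℕ} (hdL : 1 ≤ dL) (hdR : 1 ≤ dR)
    (ε η : ℝ) (hε : 0 < ε) (hη : 0 < η) (t : ℕ)
    (G : Fin t → Matrix (Fin dL) (Fin dR) ℝ)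
    (f : Matrix (Fin dL) (Fin dL) ℝ → ℝ)
    (hf : ∀ HL : Matrix (Fin dL) (Fin dL) ℝ,
      f HL = ε * dR * (HL⁻¹).trace + ∑ s, ((G s)ᵀ * HL⁻¹ * G s).trace +
        η ^ 2 * dR * HL.trace)
    (S : Matrix (Fin dL) (Fin dL) ℝ) (hS : S.PosSemidef)
    (hS2 : S * S = ε • (1 : Matrix (Fin dL) (Fin dL) ℝ) + (dR : ℝ)⁻¹ • ∑ s, G s * (G s)ᵀ) :
    (η⁻¹ • S).PosDef ∧
      ∀ HL : Matrix (Fin dL) (Fin dL) ℝ, HL.PosDef →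
        (f (η⁻¹ • S) ≤ f HL ∧ (f (η⁻¹ • S) = f HL → HL = η⁻¹ • S)) := by
  have hdR' : (0 : ℝ) < dR := by exact_mod_cast hdR
  have hSS : (S * S).PosDef := by
    rw [hS2]
    refine (PosDef.one.smul hε).add_posSemidef (PosSemidef.smul ?_ (inv_nonneg.2 hdR'.le))
    exact posSemidef_sum _ fun s _ => by
      simpa using posSemidef_self_mul_conjTranspose (G s)
  have hSpos : S.PosDef := hS.posDef_iff_isUnit.2 (isUnit_of_mul_isUnit_left hSS.isUnit)
  have hA : (η⁻¹ • S).PosDef := hSpos.smul (inv_pos.2 hη)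
  have hfA : ∀ H : Matrix (Fin dL) (Fin dL) ℝ,
      f H = η ^ 2 * dR * ((H⁻¹ * ((η⁻¹ • S) * (η⁻¹ • S))).trace + H.trace) := by
    intro H
    have hG : ∀ s, ((G s)ᵀ * H⁻¹ * G s).trace = (H⁻¹ * (G s * (G s)ᵀ)).trace := fun s => by
      rw [Matrix.mul_assoc, Matrix.trace_mul_comm, Matrix.mul_assoc]
    rw [hf]
    simp only [hG, Matrix.smul_mul, Matrix.mul_smul, hS2, Matrix.mul_add, Matrix.mul_sum,
      Matrix.mul_one, trace_smul, trace_add, trace_sum, smul_eq_mul]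
    field_simp
  have hgap : ∀ H : Matrix (Fin dL) (Fin dL) ℝ, H.PosDef →
      f H = f (η⁻¹ • S)
        + η ^ 2 * dR * ((H - η⁻¹ • S)ᴴ * H⁻¹ * (H - η⁻¹ • S)).trace := by
    intro H hH
    rw [hfA, hfA, trace_inv_mul_sq_add_trace hA.isHermitian hH,
      trace_inv_mul_sq_add_trace hA.isHermitian hA, sub_self, Matrix.mul_zero, trace_zero]
    ring
  have hc : 0 < η ^ 2 * (dR : ℝ) := by positivity
  refine ⟨hA, fun H hH => ⟨?_, fun heq => ?_⟩⟩
  · rw [hgap H hH]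
    exact le_add_of_nonneg_right (mul_nonneg hc.le
      (hH.inv.posSemidef.conjTranspose_mul_mul_same _).trace_nonneg)
  · rw [hgap H hH, left_eq_add, mul_eq_zero, or_iff_right hc.ne'] at heq
    exact sub_eq_zero.1 (eq_zero_of_trace_conjTranspose_mul_mul_same hH.inv heq)
end
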